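/- Suppose M is spherically symmetric about p and nonpositively curved, and let a ∈ (0,π) be as in the paper's Lemma 3.4 (the visibility angle for ∂Ω_1). Then for a point x = (f(θ),θ) ∈ ∂Ω (in polar coordinates), the following are equivalent: (i) x is visible; (ii) ∠(θ,u_0) ≤ a; (iii) x ∈ ∂Ω_1. -/

import Mathlib

/-!
Formalization framework for "growth competitions" (after the paper's
Section 2), at the metric-space level.

Since Mathlib does not yet have Riemannian metrics, a complete Riemannian
manifold is represented by a proper (hence complete; Hopf-Rinow) metric
space whose distance is the induced length (intrinsic) metric, and
spherical symmetry about `p` with warping function `G` is expressed through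
global geodesic polar normal coordinates `Φ : ℝⁿ ≃ M` with `Φ 0 = p` and
`dist (Φ x) p = ‖x‖`, in which the Riemannian distance is the infimum of
lengths of Lipschitz curves measured in the warped metric
`g = dr² + G(r)² dθ²`.
-/

open Set Metric Filter MeasureTheory InnerProductGeometry NNReal ENNReal
open scoped RealInnerProductSpace Classical

noncomputable section

namespace GrowthComp

variable {M : Type*} [MetricSpace M]

/-- Length of the path `γ : ℝ → M` over the time interval `[0, T]`
(the total variation of `γ` on `[0, T]`, valued in `ℝ≥0∞`). -/
def pathLength (γ : ℝ → M) (T : ℝ) : ℝ≥0∞ := eVariationOn γ (Set.Icc 0 T)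

/-- The intrinsic metric `d_S` of `M ∖ S`: the infimum of lengths of Lipschitz
paths from `x` to `y` avoiding `S` (with `sInf ∅ = ∞`). -/
def dCompl (S : Set M) (x y : M) : ℝ≥0∞ :=
  sInf {L : ℝ≥0∞ | ∃ (T : ℝ) (γ : ℝ → M), 0 ≤ T ∧ γ 0 = x ∧ γ T = y ∧
    (∃ K : ℝ≥0, LipschitzOnWith K γ (Set.Icc 0 T)) ∧
    (∀ t ∈ Set.Icc 0 T, γ t ∉ S) ∧ L = pathLength γ T}

/-- The distance of `M` is the induced length metric (true for every
complete Riemannian manifold). -/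
def IsLengthSpace (M : Type*) [MetricSpace M] : Prop :=
  ∀ x y : M, ENNReal.ofReal (dist x y) = dCompl (∅ : Set M) x y

/-- A path `γ : [0, T] → M` *avoids* the (time-indexed) family `B`:
it starts at `q`, is `λ`-Lipschitz, and `γ s ∉ B s` for all `s ∈ [0, T]`. -/
def AvoidsB (q : M) (lam : ℝ) (B : ℝ → Set M) (T : ℝ) (γ : ℝ → M) : Prop :=
  γ 0 = q ∧ LipschitzOnWith (Real.toNNReal lam) γ (Set.Icc 0 T) ∧
    ∀ s ∈ Set.Icc 0 T, γ s ∉ B s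

/-- A path `η : [0, T] → M` *avoids* the family `A`:
it starts at `p`, is `1`-Lipschitz, and `η s ∉ A s` for all `s ∈ [0, T]`. -/
def AvoidsA (p : M) (A : ℝ → Set M) (T : ℝ) (η : ℝ → M) : Prop :=
  η 0 = p ∧ LipschitzOnWith 1 η (Set.Icc 0 T) ∧ ∀ s ∈ Set.Icc 0 T, η s ∉ A s

/-- `{A_t, B_t}_{t ≥ 0}` is a *growth competition* between `p` and `q` with
speed ratio `λ`: both families are increasing, `A 0 = {q}`, `B 0 = {p}`, and
for `t > 0`, `A t` is the union of `γ([0,t])` over paths `γ` avoiding `B`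
and `B t` is the union of `η([0,t))` over paths `η` avoiding `A`. -/
structure IsGrowthCompetition (p q : M) (lam : ℝ) (A B : ℝ → Set M) : Prop where
  monoA : ∀ ⦃t₁ t₂ : ℝ⦄, 0 ≤ t₁ → t₁ ≤ t₂ → A t₁ ⊆ A t₂
  monoB : ∀ ⦃t₁ t₂ : ℝ⦄, 0 ≤ t₁ → t₁ ≤ t₂ → B t₁ ⊆ B t₂
  A_zero : A 0 = {q}
  B_zero : B 0 = {p}
  A_eq : ∀ t : ℝ, 0 < t →
    A t = {x | ∃ γ : ℝ → M, AvoidsB q lam B t γ ∧ x ∈ γ '' Set.Icc 0 t}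
  B_eq : ∀ t : ℝ, 0 < t →
    B t = {x | ∃ η : ℝ → M, AvoidsA p A t η ∧ x ∈ η '' Set.Ico 0 t}

/-- `A_∞ = ⋃_{t ≥ 0} A_t`. -/
def Ainfty (A : ℝ → Set M) : Set M := ⋃ t ∈ Set.Ici (0 : ℝ), A t

/-- `B_∞ = ⋃_{t ≥ 0} B_t`. -/
def Binfty (B : ℝ → Set M) : Set M := ⋃ t ∈ Set.Ici (0 : ℝ), B t

/-- The recursively defined sets `Ω_n`:
`Ω_0 = ∅`, `Ω_{n+1} = Ω_n ∪ {x ∈ M ∖ Ω_n | d_{Ω_n}(x, q) > λ d(x, p)}`. -/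
def OmegaSeq (p q : M) (lam : ℝ) : ℕ → Set M
  | 0 => ∅
  | n + 1 => OmegaSeq p q lam n ∪
      {x | x ∉ OmegaSeq p q lam n ∧
        ENNReal.ofReal (lam * dist x p) < dCompl (OmegaSeq p q lam n) x q}

/-- `Ω = ⋃_{n ≥ 1} Ω_n`. -/
def Omega (p q : M) (lam : ℝ) : Set M := ⋃ n : ℕ, OmegaSeq p q lam (n + 1)

/-- `γ` is a unit-speed minimizing geodesic from `x` to `y`, parametrized on
`[0, dist x y]`. -/
def IsMinGeodesicFromTo (γ : ℝ → M) (x y : M) : Prop :=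
  γ 0 = x ∧ γ (dist x y) = y ∧
    ∀ s ∈ Set.Icc (0 : ℝ) (dist x y), ∀ t ∈ Set.Icc (0 : ℝ) (dist x y),
      dist (γ s) (γ t) = |s - t|

/-- `S` is star-shaped about `p`: every minimizing geodesic from `p` to a
point of `S` lies inside `S`. -/
def StarShapedAbout (p : M) (S : Set M) : Prop :=
  ∀ x ∈ S, ∀ γ : ℝ → M, IsMinGeodesicFromTo γ p x →
    ∀ t ∈ Set.Icc (0 : ℝ) (dist p x), γ t ∈ S

/-- `x` is *visible* from `q` through the obstacle `S`: no minimizing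
geodesic joining `q` and `x` intersects `S`.  (On a nonpositively curved
simply connected manifold minimizing geodesics are unique, so this matches
"the minimizing geodesic joining `q` and `x` does not intersect `S`".) -/
def VisibleThrough (S : Set M) (q x : M) : Prop :=
  ∀ γ : ℝ → M, IsMinGeodesicFromTo γ q x →
    ∀ t ∈ Set.Icc (0 : ℝ) (dist q x), γ t ∉ S

/-! ### Spherically symmetric manifolds, via polar normal coordinates -/

/-- Euclidean `n`-space, the model space for polar normal coordinates. -/
abbrev Euc (n : ℕ) : Type := EuclideanSpace ℝ (Fin n)

/-- The norm of the tangent vector `v` at the point `x ∈ ℝⁿ ∖ {0}` in the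
spherically symmetric (warped product) metric `g = dr² + G(r)² dθ²`:
`g_x(v,v) = ⟨v, x̂⟩² + (G(‖x‖)²/‖x‖²) (‖v‖² − ⟨v, x̂⟩²)`. -/
def warpNorm {n : ℕ} (G : ℝ → ℝ) (x v : Euc n) : ℝ :=
  if x = 0 then ‖v‖
  else Real.sqrt (⟪v, ‖x‖⁻¹ • x⟫ ^ 2 +
    (G ‖x‖ / ‖x‖) ^ 2 * (‖v‖ ^ 2 - ⟪v, ‖x‖⁻¹ • x⟫ ^ 2))

/-- The length of a (Lipschitz, hence a.e. differentiable) curve `c` on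
`[0, T]` in the warped metric `dr² + G(r)² dθ²`. -/
def warpLength {n : ℕ} (G : ℝ → ℝ) (c : ℝ → Euc n) (T : ℝ) : ℝ≥0∞ :=
  ∫⁻ t in Set.Icc (0 : ℝ) T, ENNReal.ofReal (warpNorm G (c t) (deriv c t))

/-- `G` is an admissible warping function: positive and smooth on `(0,∞)`,
with `G(r) → 0` and `G(r)/r → 1` as `r → 0⁺`. -/
def IsWarping (G : ℝ → ℝ) : Prop :=
  (∀ r : ℝ, 0 < r → 0 < G r) ∧ ContDiffOn ℝ (⊤ : ℕ∞) G (Set.Ioi 0) ∧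
    Tendsto G (nhdsWithin 0 (Set.Ioi 0)) (nhds 0) ∧
    Tendsto (fun r => G r / r) (nhdsWithin 0 (Set.Ioi 0)) (nhds 1)

/-- `Φ : ℝⁿ ≃ M` realizes `M` as spherically symmetric about `p` with
warping function `G`: `Φ` is a global geodesic polar normal coordinate
chart — `Φ 0 = p` and the radial coordinate is the distance to `p` — and
the Riemannian distance of `M` is the infimum of warped lengths of
Lipschitz curves computed in the chart. -/
def IsSphericallySymmetric {n : ℕ} (p : M) (G : ℝ → ℝ) (Φ : Euc n ≃ M) : Prop :=
  IsWarping G ∧ Φ 0 = p ∧ (∀ x : Euc n, dist (Φ x) p = ‖x‖) ∧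
    ∀ x y : Euc n, ENNReal.ofReal (dist (Φ x) (Φ y)) =
      sInf {L : ℝ≥0∞ | ∃ (T : ℝ) (c : ℝ → Euc n), 0 ≤ T ∧ c 0 = x ∧ c T = y ∧
        (∃ K : ℝ≥0, LipschitzOnWith K c (Set.Icc 0 T)) ∧ L = warpLength G c T}

/-- The angular polar coordinate `θ(x) ∈ S_pM ≅ S^{n-1}` of a point
`x ≠ p`, read off through the polar chart `Φ`. -/
def polarTheta {n : ℕ} {M : Type*} [MetricSpace M] (Φ : Euc n ≃ M) (x : M) : Euc n :=
  ‖Φ.symm x‖⁻¹ • Φ.symm x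

/-- Nonpositive sectional curvature for the spherically symmetric metric
`dr² + G(r)² dθ²`: the radial sectional curvature is `−G''/G ≤ 0`,
i.e. `G` is convex, and the tangential one is `(1 − G'²)/G² ≤ 0`,
i.e. `G' ≥ 1`. -/
def NonposCurvWarping (G : ℝ → ℝ) : Prop :=
  ConvexOn ℝ (Set.Ioi 0) G ∧ ∀ r : ℝ, 0 < r → 1 ≤ deriv G r

/-- `∫₁^∞ dr / G(r) = ∞`.  For a surface of revolution this is, by a theorem
of Milnor cited in the paper, equivalent to parabolicity, i.e. conformal
equivalence to the Euclidean plane. -/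
def ParabolicWarping (G : ℝ → ℝ) : Prop :=
  ∫⁻ r in Set.Ici (1 : ℝ), ENNReal.ofReal ((G r)⁻¹) = ⊤

/-- `∫₁^∞ dr / G(r) < ∞`.  For a surface of revolution this is, by a theorem
of Milnor cited in the paper, equivalent to hyperbolicity, i.e. conformal
equivalence to the hyperbolic plane. -/
def HyperbolicWarping (G : ℝ → ℝ) : Prop :=
  ∫⁻ r in Set.Ici (1 : ℝ), ENNReal.ofReal ((G r)⁻¹) < ⊤

theorem ofReal_sub_le_warpLength {n : ℕ} {G : ℝ → ℝ} {h : Euc n → ℝ}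
    (hL : ∀ R, ∃ K : ℝ≥0, LipschitzOnWith K h (closedBall 0 R))
    (hD : ∀ (c : ℝ → Euc n) (t : ℝ) (v : Euc n) (w : ℝ), HasDerivAt c v t →
      HasDerivAt (fun s => h (c s)) w t → w ≤ warpNorm G (c t) v)
    {c : ℝ → Euc n} {T : ℝ} (hT : 0 ≤ T) (hc : ∃ K : ℝ≥0, LipschitzOnWith K c (Icc 0 T)) :
    ENNReal.ofReal (h (c T) - h (c 0)) ≤ warpLength G c T := by
  obtain ⟨K, hK⟩ := hc
  obtain ⟨R, hR⟩ := ((isCompact_Icc.image_of_continuousOn hK.continuousOn).isBounded).subset_closedBall 0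
  obtain ⟨K', hK'⟩ := hL R
  have hcomp : LipschitzOnWith (K' * K) (fun s => h (c s)) (uIcc 0 T) := by
    rw [uIcc_of_le hT]
    exact hK'.comp hK (fun s hs => hR ⟨s, hs, rfl⟩)
  have hac := hcomp.absolutelyContinuousOnInterval
  have hInt := hac.intervalIntegrable_deriv
  rw [← hac.integral_deriv_eq_sub, intervalIntegral.integral_of_le hT,
    ← integral_Icc_eq_integral_Ioc]
  have hInt' : Integrable (deriv fun s => h (c s)) (volume.restrict (Icc 0 T)) :=
    (intervalIntegrable_iff_integrableOn_Icc_of_le hT).1 hInt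
  calc ENNReal.ofReal (∫ t in Icc 0 T, deriv (fun s => h (c s)) t)
      ≤ ENNReal.ofReal (∫ t in Icc 0 T, max (deriv (fun s => h (c s)) t) 0) :=
        ENNReal.ofReal_le_ofReal (integral_mono hInt' hInt'.pos_part fun t => le_max_left _ _)
    _ = ∫⁻ t in Icc 0 T, ENNReal.ofReal (max (deriv (fun s => h (c s)) t) 0) :=
        ofReal_integral_eq_lintegral_ofReal hInt'.pos_part (ae_of_all _ fun t => le_max_right _ _)
    _ ≤ warpLength G c T := by
        refine lintegral_mono_ae ?_
        rw [ae_restrict_iff' measurableSet_Icc]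
        have h1 := hac.boundedVariationOn.ae_differentiableAt_of_mem_uIcc
        have h2 := (LipschitzOnWith.absolutelyContinuousOnInterval
          (a := 0) (b := T) (by rwa [uIcc_of_le hT])).boundedVariationOn.ae_differentiableAt_of_mem_uIcc
          (f := c)
        rw [uIcc_of_le hT] at h1 h2
        filter_upwards [h1, h2] with t ht1 ht2 ht
        have := hD c t _ _ (ht2 ht).hasDerivAt (ht1 ht).hasDerivAt
        rw [← ENNReal.ofReal_eq_ofReal_iff (le_max_right _ _) (le_max_right _ _) |>.2
          (max_eq_left (le_max_right _ _) : max (max (deriv (fun s => h (c s)) t) 0) 0 = _)]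
        have h0 : 0 ≤ warpNorm G (c t) (deriv c t) := by
          unfold warpNorm; split_ifs <;> positivity
        exact ENNReal.ofReal_le_ofReal (max_le (max_le this h0) h0)

theorem sub_le_dist_of_calibration {n : ℕ} {p : M} {G : ℝ → ℝ} {Φ : Euc n ≃ M}
    (hsym : IsSphericallySymmetric p G Φ) {h : Euc n → ℝ}
    (hL : ∀ R, ∃ K : ℝ≥0, LipschitzOnWith K h (closedBall 0 R))
    (hD : ∀ (c : ℝ → Euc n) (t : ℝ) (v : Euc n) (w : ℝ), HasDerivAt c v t →
      HasDerivAt (fun s => h (c s)) w t → w ≤ warpNorm G (c t) v) (x y : Euc n) :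
    h y - h x ≤ dist (Φ x) (Φ y) := by
  rw [← ENNReal.ofReal_le_ofReal_iff dist_nonneg, hsym.2.2.2 x y]
  refine le_sInf ?_
  rintro L ⟨T, c, hT, rfl, rfl, hc, rfl⟩
  exact ofReal_sub_le_warpLength hL hD hT hc

theorem dist_le_of_curve {n : ℕ} {p : M} {G : ℝ → ℝ} {Φ : Euc n ≃ M}
    (hsym : IsSphericallySymmetric p G Φ) {c : ℝ → Euc n} {T L : ℝ} (hT : 0 ≤ T) (hL0 : 0 ≤ L)
    (hc : ∃ K : ℝ≥0, LipschitzOnWith K c (Icc 0 T)) (hL : warpLength G c T ≤ ENNReal.ofReal L) :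
    dist (Φ (c 0)) (Φ (c T)) ≤ L := by
  rw [← ENNReal.ofReal_le_ofReal_iff hL0, hsym.2.2.2]
  refine le_trans (sInf_le ?_) hL
  exact ⟨T, c, hT, rfl, rfl, hc, rfl⟩

theorem norm_sq_sub_inner_sq_nonneg {n : ℕ} (x v : Euc n) :
    0 ≤ ‖v‖ ^ 2 - ⟪v, ‖x‖⁻¹ • x⟫ ^ 2 := by
  have h1 : ‖‖x‖⁻¹ • x‖ ≤ 1 := by
    rw [norm_smul, norm_inv, norm_norm]; exact inv_mul_le_one
  have h2 := abs_real_inner_le_norm v (‖x‖⁻¹ • x)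
  have h3 : |⟪v, ‖x‖⁻¹ • x⟫| ≤ ‖v‖ :=
    h2.trans (mul_le_of_le_one_right (norm_nonneg _) h1)
  have := sq_le_sq' (by linarith [neg_abs_le ⟪v, ‖x‖⁻¹ • x⟫, abs_nonneg ⟪v, ‖x‖⁻¹ • x⟫]) h3
  rw [sq_abs] at this
  linarith

theorem norm_le_warpNorm {n : ℕ} {G : ℝ → ℝ} (hG : ∀ r, 0 < r → r ≤ G r) (x v : Euc n) :
    ‖v‖ ≤ warpNorm G x v := by
  unfold warpNorm
  split_ifs with hx
  · exact le_rfl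
  · apply Real.le_sqrt_of_sq_le
    have hx' : 0 < ‖x‖ := norm_pos_iff.2 hx
    have h1 : 1 ≤ (G ‖x‖ / ‖x‖) ^ 2 := one_le_pow₀ ((one_le_div hx').2 (hG _ hx'))
    nlinarith [norm_sq_sub_inner_sq_nonneg x v]

theorem norm_sub_le_dist {n : ℕ} {p : M} {G : ℝ → ℝ} {Φ : Euc n ≃ M}
    (hsym : IsSphericallySymmetric p G Φ) (hG : ∀ r, 0 < r → r ≤ G r) (x y : Euc n) :
    ‖y - x‖ ≤ dist (Φ x) (Φ y) := by
  by_cases hxy : y - x = 0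
  · rw [hxy, norm_zero]; exact dist_nonneg
  have hpos := norm_pos_iff.2 hxy
  have key := sub_le_dist_of_calibration hsym (h := fun z => ⟪‖y - x‖⁻¹ • (y - x), z⟫) ?_ ?_ x y
  · refine le_trans (le_of_eq ?_) key
    rw [← inner_sub_right, real_inner_smul_left, real_inner_self_eq_norm_sq]
    field_simp
  · intro R
    exact ⟨_, (innerSL ℝ (‖y - x‖⁻¹ • (y - x))).lipschitz.lipschitzOnWith⟩
  · intro c t v w hc hw
    have h1 : HasDerivAt (fun s => ⟪‖y - x‖⁻¹ • (y - x), c s⟫) ⟪‖y - x‖⁻¹ • (y - x), v⟫ t := by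
      exact (innerSL ℝ (‖y - x‖⁻¹ • (y - x))).hasFDerivAt.comp_hasDerivAt t hc
    rw [hw.unique h1]
    refine (real_inner_le_norm _ _).trans ?_
    rw [norm_smul, norm_inv, norm_norm, inv_mul_cancel₀ hpos.ne', one_mul]
    exact norm_le_warpNorm hG _ _

theorem warpNorm_smul_smul {n : ℕ} (G : ℝ → ℝ) {w : Euc n} (hw : ‖w‖ = 1) (s k : ℝ) :
    warpNorm G (s • w) (k • w) = |k| := by
  unfold warpNorm
  split_ifs with h
  · rw [norm_smul, hw, mul_one, Real.norm_eq_abs]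
  · have hs : s ≠ 0 := by rintro rfl; simp at h
    have h1 : ⟪k • w, ‖s • w‖⁻¹ • s • w⟫ ^ 2 = k ^ 2 := by
      rw [real_inner_smul_left, real_inner_smul_right, real_inner_smul_right,
        real_inner_self_eq_norm_sq, norm_smul, hw, Real.norm_eq_abs]
      have : |s| ≠ 0 := abs_ne_zero.2 hs
      field_simp
      rw [sq_abs]
    rw [h1, norm_smul k w, hw, Real.norm_eq_abs, mul_one, sq_abs, sub_self, mul_zero, add_zero,
      Real.sqrt_sq_eq_abs]

theorem dist_smul_smul {n : ℕ} {p : M} {G : ℝ → ℝ} {Φ : Euc n ≃ M}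
    (hsym : IsSphericallySymmetric p G Φ) (hG : ∀ r, 0 < r → r ≤ G r) {w : Euc n} (hw : ‖w‖ = 1)
    (s t : ℝ) : dist (Φ (s • w)) (Φ (t • w)) = |s - t| := by
  apply le_antisymm
  · have hd : ∀ τ : ℝ, HasDerivAt (fun τ : ℝ => (s + τ * (t - s)) • w) ((t - s) • w) τ := by
      intro τ
      have := ((((hasDerivAt_id τ).mul_const (t - s)).const_add s)).smul_const w
      simpa using this
    have := dist_le_of_curve hsym (c := fun τ : ℝ => (s + τ * (t - s)) • w) (T := 1) (L := |s - t|)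
      zero_le_one (abs_nonneg _) ⟨‖(t - s) • w‖₊, ?_⟩ ?_
    · simpa using this
    · exact (convex_Icc 0 1).lipschitzOnWith_of_nnnorm_hasDerivWithin_le
        (fun x _ => (hd x).hasDerivWithinAt) (fun x _ => le_rfl)
    · unfold warpLength
      simp_rw [fun τ => (hd τ).deriv, warpNorm_smul_smul G hw]
      simp [abs_sub_comm]
  · have := norm_sub_le_dist hsym hG (s • w) (t • w)
    rwa [← sub_smul, norm_smul, hw, mul_one, Real.norm_eq_abs, abs_sub_comm] at this

/-- A radial profile on the whole line: `g` is `C¹` and convex with `g 0 = 0`, `g' 0 = 1`,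
`g' = g₁ ≥ 1`, and `H` is its continuous inverse. -/
structure IsRadialProfile (g g₁ H : ℝ → ℝ) : Prop where
  hasDerivAt : ∀ r, HasDerivAt g (g₁ r) r
  continuous_deriv : Continuous g₁
  one_le : ∀ r, 1 ≤ g₁ r
  map_zero : g 0 = 0
  deriv_zero : g₁ 0 = 1
  tangent_le : ∀ r ρ, g ρ + g₁ ρ * (r - ρ) ≤ g r
  continuous_inv : Continuous H
  inv_apply : ∀ r, H (g r) = r
  apply_inv : ∀ y, g (H y) = y

theorem exists_isRadialProfile {G : ℝ → ℝ} (hG : IsWarping G) (hnpc : NonposCurvWarping G) :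
    ∃ g g₁ H, IsRadialProfile g g₁ H ∧ ∀ r, 0 < r → g r = G r := by
  obtain ⟨hpos, hsm, hlim, hlim1⟩ := hG
  obtain ⟨hconv, hder⟩ := hnpc
  let g : ℝ → ℝ := fun r => if r ≤ 0 then r else G r
  let g₁ : ℝ → ℝ := fun r => if r ≤ 0 then 1 else deriv G r
  have hgG : ∀ r, 0 < r → g r = G r := fun r hr => if_neg hr.not_ge
  have hg1G : ∀ r, 0 < r → g₁ r = deriv G r := fun r hr => if_neg hr.not_ge
  have hdiff : ∀ r, 0 < r → DifferentiableAt ℝ G r := fun r hr =>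
    (hsm.differentiableOn (by simp)).differentiableAt (Ioi_mem_nhds hr)
  have hd : ∀ r, HasDerivAt g (g₁ r) r := by
    intro r
    rcases lt_trichotomy r 0 with hr | rfl | hr
    · have h1 : g₁ r = 1 := if_pos hr.le
      rw [h1]
      refine (hasDerivAt_id r).congr_of_eventuallyEq ?_
      filter_upwards [Iio_mem_nhds hr] with s hs
      exact if_pos (le_of_lt hs)
    · have h1 : g₁ 0 = 1 := if_pos le_rfl
      rw [h1, hasDerivAt_iff_tendsto_slope, ← nhdsLT_sup_nhdsGT]
      refine Tendsto.sup ?_ ?_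
      · refine tendsto_const_nhds.congr' ?_
        filter_upwards [self_mem_nhdsWithin] with s hs
        have : s ≠ 0 := ne_of_lt hs
        simp [slope, g, le_of_lt (show s < 0 from hs), this]
      · refine hlim1.congr' ?_
        filter_upwards [self_mem_nhdsWithin] with s hs
        have : ¬ s ≤ 0 := not_le.2 hs
        simp [slope, g, this, div_eq_inv_mul]
    · rw [hg1G r hr]
      refine (hdiff r hr).hasDerivAt.congr_of_eventuallyEq ?_
      filter_upwards [Ioi_mem_nhds hr] with s hs
      exact hgG s hs
  have hone : ∀ r, 1 ≤ g₁ r := by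
    intro r
    by_cases hr : r ≤ 0
    · exact (if_pos hr).ge
    · rw [hg1G r (not_le.1 hr)]; exact hder r (not_le.1 hr)
  have hmono : Monotone g₁ := by
    intro r s hrs
    by_cases hr : r ≤ 0
    · exact (if_pos hr : g₁ r = 1).le.trans (hone s)
    · rw [not_le] at hr
      rw [hg1G r hr, hg1G s (hr.trans_le hrs)]
      exact hconv.monotoneOn_deriv (fun x hx => hdiff x hx) hr (hr.trans_le hrs) hrs
  have hcont : Continuous g₁ := by
    rw [continuous_iff_continuousAt]
    intro r
    rcases lt_trichotomy r 0 with hr | rfl | hr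
    · refine ContinuousAt.congr (f := fun _ => (1 : ℝ)) continuousAt_const ?_
      filter_upwards [Iio_mem_nhds hr] with s hs
      exact (if_pos (le_of_lt hs)).symm
    · rw [continuousAt_iff_continuous_left'_right']
      have h1 : g₁ 0 = 1 := if_pos le_rfl
      constructor
      · rw [ContinuousWithinAt, h1]
        refine tendsto_const_nhds.congr' ?_
        filter_upwards [self_mem_nhdsWithin] with s hs
        exact (if_pos (le_of_lt hs)).symm
      · rw [ContinuousWithinAt, h1]
        have hdouble : Tendsto (fun r : ℝ => 2 * r) (nhdsWithin 0 (Ioi 0)) (nhdsWithin 0 (Ioi 0)) := by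
          refine tendsto_nhdsWithin_iff.2 ⟨?_, ?_⟩
          · have : Tendsto (fun r : ℝ => 2 * r) (nhds 0) (nhds (2 * 0)) :=
              tendsto_id.const_mul 2
            rw [mul_zero] at this
            exact this.mono_left nhdsWithin_le_nhds
          · filter_upwards [self_mem_nhdsWithin] with s hs
            exact mem_Ioi.2 (mul_pos two_pos (mem_Ioi.1 hs))
        have hup : Tendsto (fun r => 2 * (G (2 * r) / (2 * r)) - G r / r) (nhdsWithin 0 (Ioi 0))
            (nhds 1) := by
          have := ((hlim1.comp hdouble).const_mul 2).sub hlim1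
          norm_num at this
          exact this
        refine tendsto_of_tendsto_of_tendsto_of_le_of_le' tendsto_const_nhds hup
          (Eventually.of_forall hone) ?_
        filter_upwards [self_mem_nhdsWithin] with s hs
        have hs : 0 < s := hs
        rw [hg1G s hs]
        have h2 := hconv.deriv_le_slope (x := s) (y := 2 * s) hs (by simp [hs]) (by linarith)
          (hdiff s hs)
        refine h2.trans (le_of_eq ?_)
        rw [slope_def_field]
        field_simp
        ring
    · refine ContinuousAt.congr (f := deriv G) ?_ ?_
      · have := hsm.continuousOn_deriv_of_isOpen isOpen_Ioi (by simp)
        exact this.continuousAt (Ioi_mem_nhds hr)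
      · filter_upwards [Ioi_mem_nhds hr] with s hs
        exact (hg1G s hs).symm
  have hstrict : StrictMono g := strictMono_of_deriv_pos fun r => by
    rw [(hd r).deriv]; linarith [hone r]
  have hcg : Continuous g := continuous_iff_continuousAt.2 fun r => (hd r).continuousAt
  have hcvx : ConvexOn ℝ univ g := Monotone.convexOn_univ_of_deriv
    (fun r => (hd r).differentiableAt) (by rwa [show deriv g = g₁ from funext fun r => (hd r).deriv])
  have hzero : g 0 = 0 := if_pos le_rfl
  have htan : ∀ r ρ, g ρ + g₁ ρ * (r - ρ) ≤ g r := by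
    intro r ρ
    rcases lt_trichotomy r ρ with h | rfl | h
    · have := hcvx.slope_le_deriv (mem_univ r) (mem_univ ρ) h (hd ρ).differentiableAt
      rw [(hd ρ).deriv, slope_def_field, div_le_iff₀ (by linarith)] at this
      linarith
    · simp
    · have := hcvx.deriv_le_slope (mem_univ ρ) (mem_univ r) h (hd ρ).differentiableAt
      rw [(hd ρ).deriv, slope_def_field, le_div_iff₀ (by linarith)] at this
      linarith
  have hge : ∀ r, 0 ≤ r → r ≤ g r := fun r hr => by
    have := htan r 0
    have h1 : g₁ 0 = 1 := if_pos le_rfl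
    rw [hzero, h1] at this
    linarith
  have hsurj : Function.Surjective g := by
    refine hcg.surjective ?_ ?_
    · exact tendsto_atTop_mono' _ ((eventually_ge_atTop 0).mono hge) tendsto_id
    · refine tendsto_id.congr' ?_
      filter_upwards [eventually_le_atBot 0] with s hs
      exact (if_pos hs).symm
  let e := hstrict.orderIsoOfSurjective g hsurj
  exact ⟨g, g₁, e.symm, ⟨hd, hcont, hone, hzero, if_pos le_rfl, htan, e.symm.continuous,
    fun r => e.symm_apply_apply r, fun y => e.apply_symm_apply y⟩, hgG⟩

namespace IsRadialProfile

variable {g g₁ H : ℝ → ℝ}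

theorem pos_deriv (h : IsRadialProfile g g₁ H) (r : ℝ) : 0 < g₁ r := one_pos.trans_le (h.one_le r)

theorem strictMono (h : IsRadialProfile g g₁ H) : StrictMono g :=
  strictMono_of_deriv_pos fun r => by rw [(h.hasDerivAt r).deriv]; exact h.pos_deriv r

theorem continuous (h : IsRadialProfile g g₁ H) : Continuous g :=
  continuous_iff_continuousAt.2 fun r => (h.hasDerivAt r).continuousAt

theorem self_le (h : IsRadialProfile g g₁ H) (r : ℝ) : r ≤ g r := by
  have := h.tangent_le r 0
  rw [h.map_zero, h.deriv_zero] at this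
  linarith

theorem pos (h : IsRadialProfile g g₁ H) {r : ℝ} (hr : 0 < r) : 0 < g r :=
  hr.trans_le (h.self_le r)

theorem nonneg (h : IsRadialProfile g g₁ H) {r : ℝ} (hr : 0 ≤ r) : 0 ≤ g r :=
  hr.trans (h.self_le r)

theorem inv_zero (h : IsRadialProfile g g₁ H) : H 0 = 0 := by
  rw [← h.map_zero, h.inv_apply, h.map_zero]

theorem inv_pos (h : IsRadialProfile g g₁ H) {y : ℝ} (hy : 0 < y) : 0 < H y := by
  rw [← h.strictMono.lt_iff_lt, h.apply_inv, h.map_zero]; exact hy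

theorem hasDerivAt_inv (h : IsRadialProfile g g₁ H) (y : ℝ) : HasDerivAt H (1 / g₁ (H y)) y := by
  rw [one_div]
  exact HasDerivAt.of_local_left_inverse h.continuous_inv.continuousAt (h.hasDerivAt _)
    (h.pos_deriv _).ne' (Eventually.of_forall h.apply_inv)

theorem sub_div_nonneg (h : IsRadialProfile g g₁ H) (ρ : ℝ) : 0 ≤ ρ - g ρ / g₁ ρ := by
  have := h.tangent_le 0 ρ
  rw [h.map_zero] at this
  rw [sub_nonneg, div_le_iff₀ (h.pos_deriv ρ)]
  linarith

theorem sub_add_div_le (h : IsRadialProfile g g₁ H) (r ρ : ℝ) :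
    r - (ρ - g ρ / g₁ ρ) ≤ g r / g₁ ρ := by
  have := h.tangent_le r ρ
  have h1 := h.pos_deriv ρ
  rw [le_div_iff₀ h1]
  have : (r - (ρ - g ρ / g₁ ρ)) * g₁ ρ = g ρ + g₁ ρ * (r - ρ) := by field_simp; ring
  linarith

end IsRadialProfile

/-- A solution `(ρ, φ)` of the geodesic equations of `dr² + g(r)² dφ²`, parametrized by the angle
`χ` between the geodesic and the circles of constant radius. -/
structure IsExtremal (g g₁ : ℝ → ℝ) (χ₀ χ₁ : ℝ) (ρ φ : ℝ → ℝ) : Prop where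
  lt : χ₀ < χ₁
  left_mem : -(Real.pi / 2) < χ₀
  right_mem : χ₁ < Real.pi / 2
  pos : ∀ χ ∈ Ioo (-(Real.pi / 2)) (Real.pi / 2), 0 < ρ χ
  hasDerivAt_angle : ∀ χ ∈ Ioo (-(Real.pi / 2)) (Real.pi / 2),
    HasDerivAt φ (1 / g₁ (ρ χ)) χ
  hasDerivAt_radius : ∀ χ ∈ Ioo (-(Real.pi / 2)) (Real.pi / 2),
    HasDerivAt ρ (g (ρ χ) * Real.tan χ / g₁ (ρ χ)) χ

theorem exists_initial_slope {k : ℝ → ℝ} (hk : Continuous k) (hk0 : k 0 = 1) (hkpos : ∀ y, 0 ≤ k y)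
    (hk1 : ∀ y, k y ≤ 1) {A B α : ℝ} (hα : 0 < α) (hαπ : α < Real.pi) :
    ∃ χ₀ ∈ Ioo (-(Real.pi / 2)) (Real.pi / 2),
      ∫ t in χ₀..Real.arccos (A * Real.cos χ₀ / B), k (A * Real.cos χ₀ / Real.cos t) = α := by
  have hπ := Real.pi_pos
  let P : ℝ × ℝ → ℝ := fun p => ∫ t in (0 : ℝ)..p.2, k (A * Real.cos p.1 / Real.cos t)
  have hmeas : ∀ x, Measurable fun t => k (A * Real.cos x / Real.cos t) := fun x =>
    hk.measurable.comp (measurable_const.div Real.continuous_cos.measurable)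
  have hbd : ∀ x t, ‖k (A * Real.cos x / Real.cos t)‖ ≤ 1 := fun x t => by
    rw [Real.norm_eq_abs, abs_of_nonneg (hkpos _)]; exact hk1 _
  have hP : ∀ x s, s ∈ Ioo (-5 : ℝ) 5 → ContinuousAt P (x, s) := by
    intro x s hs
    refine intervalIntegral.continuousAt_parametric_primitive_of_dominated (fun _ => 1) (-5) 5
      (fun x => (hmeas x).aestronglyMeasurable) ?_ intervalIntegrable_const ?_ (by norm_num) hs
      (measure_singleton _)
    · exact Eventually.of_forall fun x => ae_of_all _ fun t => hbd x t
    · refine ae_of_all _ fun t => ?_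
      exact (hk.comp ((continuous_const.mul Real.continuous_cos).div_const _)).continuousAt
  have hInt : ∀ x a b, IntervalIntegrable (fun t => k (A * Real.cos x / Real.cos t)) volume a b :=
    fun x a b => (intervalIntegrable_const (c := (1 : ℝ))).mono_fun'
      (hmeas x).aestronglyMeasurable (ae_of_all _ fun t => hbd x t)
  let F : ℝ → ℝ := fun x =>
    ∫ t in x..Real.arccos (A * Real.cos x / B), k (A * Real.cos x / Real.cos t)
  have hF : ∀ x, F x = P (x, Real.arccos (A * Real.cos x / B)) - P (x, x) := fun x =>
    (intervalIntegral.integral_interval_sub_left (hInt x _ _) (hInt x _ _)).symm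
  have hFc : ContinuousOn F (Icc (-(Real.pi / 2)) (Real.pi / 2)) := by
    intro x hx
    have hπ4 := Real.pi_lt_four
    rw [show F = fun x => P (x, Real.arccos (A * Real.cos x / B)) - P (x, x) from funext hF]
    have hc : Continuous fun x => Real.arccos (A * Real.cos x / B) :=
      Real.continuous_arccos.comp ((continuous_const.mul Real.continuous_cos).div_const _)
    refine ContinuousAt.continuousWithinAt (ContinuousAt.sub ?_ ?_)
    · exact ContinuousAt.comp (g := P) (f := fun x => (x, Real.arccos (A * Real.cos x / B)))
        (hP _ _ ⟨by linarith [Real.arccos_nonneg (A * Real.cos x / B)],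
          by linarith [Real.arccos_le_pi (A * Real.cos x / B)]⟩)
        (continuous_id.prodMk hc).continuousAt
    · exact ContinuousAt.comp (g := P) (f := fun x => (x, x))
        (hP _ _ ⟨by linarith [hx.1], by linarith [hx.2]⟩)
        (continuous_id.prodMk continuous_id).continuousAt
  have hF0 : F (-(Real.pi / 2)) = Real.pi := by
    simp only [F, Real.cos_neg, Real.cos_pi_div_two, mul_zero, zero_div, Real.arccos_zero, hk0]
    simp
  have hF1 : F (Real.pi / 2) = 0 := by
    simp only [F, Real.cos_pi_div_two, mul_zero, zero_div, Real.arccos_zero,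
      intervalIntegral.integral_same]
  obtain ⟨x, hx, hFx⟩ := intermediate_value_Icc' (by linarith) hFc
    (show α ∈ Icc (F (Real.pi / 2)) (F (-(Real.pi / 2))) from ⟨by linarith, by linarith⟩)
  refine ⟨x, ⟨lt_of_le_of_ne hx.1 ?_, lt_of_le_of_ne hx.2 ?_⟩, hFx⟩
  · rintro rfl; linarith
  · rintro rfl; linarith

theorem exists_extremal {g g₁ H : ℝ → ℝ} (h : IsRadialProfile g g₁ H) {l R α : ℝ} (hl : 0 < l)
    (hlR : l ≤ R) (hα : 0 < α) (hαπ : α < Real.pi) :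
    ∃ χ₀ χ₁ ρ φ, IsExtremal g g₁ χ₀ χ₁ ρ φ ∧ ρ χ₀ = l ∧ ρ χ₁ = R ∧ φ χ₀ = 0 ∧ φ χ₁ = α := by
  have hA := h.pos hl
  have hAB : g l ≤ g R := h.strictMono.monotone hlR
  have hB := hA.trans_le hAB
  have hkc : Continuous fun y => 1 / g₁ (H y) :=
    continuous_const.div (h.continuous_deriv.comp h.continuous_inv) fun y => (h.pos_deriv _).ne'
  obtain ⟨χ₀, hχ₀, hI⟩ := exists_initial_slope (k := fun y => 1 / g₁ (H y)) hkc
    (by simp [h.inv_zero, h.deriv_zero]) (fun y => (one_div_pos.2 (h.pos_deriv _)).le)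
    (fun y => (div_le_one (h.pos_deriv _)).2 (h.one_le _)) hα hαπ
  set J := g l * Real.cos χ₀ with hJ
  have hcos : ∀ χ ∈ Ioo (-(Real.pi / 2)) (Real.pi / 2), 0 < Real.cos χ := fun χ hχ =>
    Real.cos_pos_of_mem_Ioo hχ
  have hJpos : 0 < J := mul_pos hA (hcos _ hχ₀)
  have hJB : J / g R ≤ Real.cos χ₀ := by
    rw [div_le_iff₀ hB, hJ, mul_comm]
    exact mul_le_mul_of_nonneg_left hAB (hcos _ hχ₀).le
  have hcos1 : Real.cos (Real.arccos (J / g R)) = J / g R :=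
    Real.cos_arccos (by linarith [div_pos hJpos hB]) (hJB.trans (Real.cos_le_one _))
  have hlt1 : Real.arccos (J / g R) < Real.pi / 2 :=
    Real.arccos_lt_pi_div_two.2 (div_pos hJpos hB)
  have hle : χ₀ ≤ Real.arccos (J / g R) := by
    have h1 := Real.arccos_le_arccos hJB
    rw [← Real.cos_abs, Real.arccos_cos (abs_nonneg _)
      (by rw [abs_le]; constructor <;> linarith [hχ₀.1, hχ₀.2, Real.pi_pos])] at h1
    exact (le_abs_self _).trans h1
  have hlt : χ₀ < Real.arccos (J / g R) := by
    refine lt_of_le_of_ne hle fun heq => ?_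
    rw [← heq, intervalIntegral.integral_same] at hI
    exact hα.ne hI
  have hcontOn : ContinuousOn (fun t => 1 / g₁ (H (J / Real.cos t)))
      (Ioo (-(Real.pi / 2)) (Real.pi / 2)) :=
    hkc.comp_continuousOn (continuousOn_const.div Real.continuous_cos.continuousOn
      fun t ht => (hcos t ht).ne')
  refine ⟨χ₀, Real.arccos (J / g R), fun χ => H (J / Real.cos χ),
    fun χ => ∫ t in χ₀..χ, 1 / g₁ (H (J / Real.cos t)), ⟨hlt, hχ₀.1, hlt1, ?_, ?_, ?_⟩,
    ?_, ?_, intervalIntegral.integral_same, hI⟩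
  · exact fun χ hχ => h.inv_pos (div_pos hJpos (hcos χ hχ))
  · intro χ hχ
    refine intervalIntegral.integral_hasDerivAt_right ?_ ?_ ?_
    · exact (hcontOn.mono (ordConnected_Ioo.uIcc_subset hχ₀ hχ)).intervalIntegrable
    · exact hcontOn.stronglyMeasurableAtFilter isOpen_Ioo χ hχ
    · exact hcontOn.continuousAt (isOpen_Ioo.mem_nhds hχ)
  · intro χ hχ
    have h1 := (hcos χ hχ).ne'
    have h2 : HasDerivAt (fun χ => J / Real.cos χ) (J * Real.sin χ / Real.cos χ ^ 2) χ := by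
      have := (hasDerivAt_const χ J).div (Real.hasDerivAt_cos χ) h1
      refine this.congr_deriv ?_
      ring
    refine ((h.hasDerivAt_inv (J / Real.cos χ)).comp χ h2).congr_deriv ?_
    rw [h.apply_inv, Real.tan_eq_sin_div_cos]
    field_simp
  · change H (J / Real.cos χ₀) = l
    rw [hJ, mul_div_assoc, div_self (hcos _ hχ₀).ne', mul_one, h.inv_apply]
  · change H (J / Real.cos (Real.arccos (J / g R))) = R
    rw [hcos1, div_div_cancel₀ hJpos.ne', h.inv_apply]

namespace IsExtremal

variable {g g₁ H : ℝ → ℝ} {χ₀ χ₁ : ℝ} {ρ φ : ℝ → ℝ}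

theorem mem_Ioo (E : IsExtremal g g₁ χ₀ χ₁ ρ φ) {χ : ℝ} (hχ : χ ∈ Icc χ₀ χ₁) :
    χ ∈ Ioo (-(Real.pi / 2)) (Real.pi / 2) :=
  ⟨E.left_mem.trans_le hχ.1, hχ.2.trans_lt E.right_mem⟩

theorem reverse (E : IsExtremal g g₁ χ₀ χ₁ ρ φ) (α : ℝ) :
    IsExtremal g g₁ (-χ₁) (-χ₀) (fun χ => ρ (-χ)) (fun χ => α - φ (-χ)) := by
  have hneg : ∀ χ ∈ Ioo (-(Real.pi / 2)) (Real.pi / 2), -χ ∈ Ioo (-(Real.pi / 2)) (Real.pi / 2) :=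
    fun χ hχ => ⟨by linarith [hχ.2], by linarith [hχ.1]⟩
  refine ⟨neg_lt_neg E.lt, by linarith [E.right_mem], by linarith [E.left_mem],
    fun χ hχ => E.pos _ (hneg χ hχ), fun χ hχ => ?_, fun χ hχ => ?_⟩
  · refine (((E.hasDerivAt_angle _ (hneg χ hχ)).comp χ (hasDerivAt_neg χ)).const_sub α).congr_deriv ?_
    ring
  · refine ((E.hasDerivAt_radius _ (hneg χ hχ)).comp χ (hasDerivAt_neg χ)).congr_deriv ?_
    rw [Real.tan_neg]
    ring

theorem strictMonoOn_angle (E : IsExtremal g g₁ χ₀ χ₁ ρ φ) (h : IsRadialProfile g g₁ H) :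
    StrictMonoOn φ (Ioo (-(Real.pi / 2)) (Real.pi / 2)) := by
  refine strictMonoOn_of_deriv_pos (convex_Ioo _ _)
    (fun χ hχ => (E.hasDerivAt_angle χ hχ).continuousAt.continuousWithinAt) fun χ hχ => ?_
  rw [interior_Ioo] at hχ
  rw [(E.hasDerivAt_angle χ hχ).deriv]
  exact one_div_pos.2 (h.pos_deriv _)

theorem continuousOn_angle (E : IsExtremal g g₁ χ₀ χ₁ ρ φ) : ContinuousOn φ (Icc χ₀ χ₁) :=
  fun _ hχ => (E.hasDerivAt_angle _ (E.mem_Ioo hχ)).continuousAt.continuousWithinAt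

theorem continuousOn_radius (E : IsExtremal g g₁ χ₀ χ₁ ρ φ) :
    ContinuousOn ρ (Ioo (-(Real.pi / 2)) (Real.pi / 2)) :=
  fun _ hχ => (E.hasDerivAt_radius _ hχ).continuousAt.continuousWithinAt

end IsExtremal

theorem angle_le_sqrt_div {n : ℕ} {x y : Euc n} (hx : x ≠ 0) (hpos : 0 < ⟪y, ‖x‖⁻¹ • x⟫) :
    angle x y ≤ √(‖y‖ ^ 2 - ⟪y, ‖x‖⁻¹ • x⟫ ^ 2) / ⟪y, ‖x‖⁻¹ • x⟫ := by
  have hx' := norm_pos_iff.2 hx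
  have hy : y ≠ 0 := by rintro rfl; simp at hpos
  have hy' := norm_pos_iff.2 hy
  have h1 : ⟪y, ‖x‖⁻¹ • x⟫ = ‖y‖ * Real.cos (angle x y) := by
    rw [real_inner_smul_right, real_inner_comm, ← cos_angle_mul_norm_mul_norm x y]
    field_simp
  rw [h1] at hpos ⊢
  have hcos : 0 < Real.cos (angle x y) := pos_of_mul_pos_right hpos hy'.le
  have hsin := sin_angle_nonneg x y
  have h2 : ‖y‖ ^ 2 - (‖y‖ * Real.cos (angle x y)) ^ 2 = (‖y‖ * Real.sin (angle x y)) ^ 2 := by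
    linear_combination (-‖y‖ ^ 2) * Real.sin_sq_add_cos_sq (angle x y)
  rw [h2, Real.sqrt_sq (by positivity), mul_div_mul_left _ _ hy'.ne', ← Real.tan_eq_sin_div_cos]
  refine Real.le_tan (angle_nonneg _ _) ?_
  by_contra hcon
  exact hcos.not_ge (Real.cos_nonpos_of_pi_div_two_le_of_le (not_lt.1 hcon)
    (by linarith [angle_le_pi x y, Real.pi_pos]))

theorem norm_mul_angle_le {n : ℕ} (x y : Euc n) : ‖x‖ * angle x y ≤ Real.pi * ‖x - y‖ := by
  have hπ := Real.pi_pos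
  have h0 := norm_sub_sq_eq_norm_sq_add_norm_sq_sub_two_mul_norm_mul_norm_mul_cos_angle x y
  have hxn := norm_nonneg x
  have hyn := norm_nonneg y
  rcases le_total (angle x y) (Real.pi / 2) with h | h
  · have h1 := Real.mul_le_sin (angle_nonneg x y) h
    have h2 : ‖x‖ * Real.sin (angle x y) ≤ ‖x - y‖ := by
      refine abs_le_of_sq_le_sq' ?_ (norm_nonneg _) |>.2
      nlinarith [Real.sin_sq_add_cos_sq (angle x y), sq_nonneg (‖y‖ - ‖x‖ * Real.cos (angle x y))]
    have h3 : ‖x‖ * (2 / Real.pi * angle x y) ≤ ‖x - y‖ :=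
      (mul_le_mul_of_nonneg_left h1 hxn).trans h2
    have h4 : ‖x‖ * angle x y = Real.pi / 2 * (‖x‖ * (2 / Real.pi * angle x y)) := by
      field_simp
    rw [h4]
    have := mul_le_mul_of_nonneg_left h3 (by positivity : 0 ≤ Real.pi / 2)
    nlinarith [norm_nonneg (x - y)]
  · have hc := Real.cos_nonpos_of_pi_div_two_le_of_le h
      (by linarith [angle_le_pi x y, Real.pi_pos])
    have h2 : ‖x‖ ≤ ‖x - y‖ := by
      refine abs_le_of_sq_le_sq' ?_ (norm_nonneg _) |>.2
      nlinarith [mul_nonneg hxn hyn, sq_nonneg ‖y‖]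
    nlinarith [angle_le_pi x y, angle_nonneg x y]

/-- A function whose increments are controlled by the warped metric up to an error quadratic in the
angle is a calibration. -/
theorem sub_le_dist_of_increment {n : ℕ} {p : M} {G : ℝ → ℝ} {Φ : Euc n ≃ M}
    (hsym : IsSphericallySymmetric p G Φ) {h : Euc n → ℝ} {m : ℝ} (hm : 0 ≤ m)
    (hGK : ∀ R, ∃ K, ∀ r, 0 < r → r ≤ R → G r ≤ K * r)
    (h0 : ∀ y, h y - h 0 ≤ ‖y‖)
    (h1 : ∀ x y, x ≠ 0 → ∀ δ, angle x y ≤ δ →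
      h y - h x ≤ √((‖y‖ - ‖x‖) ^ 2 + (G ‖x‖ * δ) ^ 2) + m * G ‖x‖ * δ ^ 2)
    (x y : Euc n) : h y - h x ≤ dist (Φ x) (Φ y) := by
  refine sub_le_dist_of_calibration hsym ?_ ?_ x y
  · intro R
    obtain ⟨K, hK⟩ := hGK R
    refine ⟨Real.toNNReal (1 + |K| * Real.pi * (1 + m * Real.pi)),
      LipschitzOnWith.of_le_add_mul _ fun y hy x hx => ?_⟩
    rw [Real.coe_toNNReal _ (by positivity)]
    rw [mem_closedBall_zero_iff] at hx hy
    rw [dist_eq_norm]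
    have hmain : h y - h x ≤ ‖y - x‖ * (1 + |K| * Real.pi * (1 + m * Real.pi)) := by
      by_cases hx0 : x = 0
      · subst hx0
        refine (h0 y).trans ?_
        rw [sub_zero]
        exact le_mul_of_one_le_right (norm_nonneg _)
          (le_add_of_nonneg_right (by positivity))
      · have hxp := norm_pos_iff.2 hx0
        have hG := hsym.1.1 _ hxp
        have ha := angle_nonneg x y
        have h2 := h1 x y hx0 _ le_rfl
        have h3 : √((‖y‖ - ‖x‖) ^ 2 + (G ‖x‖ * angle x y) ^ 2) ≤
            ‖y - x‖ + G ‖x‖ * angle x y := by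
          refine Real.sqrt_le_iff.2 ⟨by positivity, ?_⟩
          have h5 := sq_le_sq' (by linarith [abs_norm_sub_norm_le y x, neg_abs_le (‖y‖ - ‖x‖)])
            ((le_abs_self _).trans (abs_norm_sub_norm_le y x))
          nlinarith [mul_nonneg (norm_nonneg (y - x)) (mul_nonneg hG.le ha)]
        have h4 : G ‖x‖ * angle x y ≤ |K| * Real.pi * ‖y - x‖ := by
          have h6 := norm_mul_angle_le x y
          rw [norm_sub_rev] at h6
          calc G ‖x‖ * angle x y ≤ (|K| * ‖x‖) * angle x y :=
                mul_le_mul_of_nonneg_right ((hK _ hxp hx).trans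
                  (mul_le_mul_of_nonneg_right (le_abs_self K) hxp.le)) ha
            _ = |K| * (‖x‖ * angle x y) := by ring
            _ ≤ |K| * (Real.pi * ‖y - x‖) := mul_le_mul_of_nonneg_left h6 (abs_nonneg K)
            _ = _ := by ring
        have h5 : m * G ‖x‖ * angle x y ^ 2 ≤ m * Real.pi * (G ‖x‖ * angle x y) := by
          have : m * G ‖x‖ * angle x y ^ 2 = m * angle x y * (G ‖x‖ * angle x y) := by ring
          rw [this]
          gcongr
          exact angle_le_pi x y
        have h6 := mul_le_mul_of_nonneg_left h4 (by positivity : 0 ≤ 1 + m * Real.pi)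
        linarith
    linarith
  · intro c t v w hc hw
    have hcs := (hasDerivAt_iff_tendsto_slope_left_right.1 hc).2
    have hws := (hasDerivAt_iff_tendsto_slope_left_right.1 hw).2
    by_cases hx0 : c t = 0
    · rw [warpNorm, if_pos hx0]
      refine le_of_tendsto_of_tendsto hws hcs.norm ?_
      filter_upwards [self_mem_nhdsWithin] with s hs
      have hst : 0 < s - t := sub_pos.2 hs
      rw [slope_def_field, slope_def_module, hx0, sub_zero, norm_smul, norm_inv, Real.norm_eq_abs,
        abs_of_pos hst, div_eq_inv_mul]
      exact mul_le_mul_of_nonneg_left (h0 (c s)) (inv_nonneg.2 hst.le)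
    · rw [warpNorm, if_neg hx0]
      set e : Euc n := ‖c t‖⁻¹ • c t with he
      have hxp := norm_pos_iff.2 hx0
      have hce : ⟪c t, e⟫ = ‖c t‖ := by
        rw [he, real_inner_smul_right, real_inner_self_eq_norm_sq]; field_simp
      have hnorm : HasDerivAt (fun s => ‖c s‖) ⟪v, e⟫ t := by
        have h2 := (hc.norm_sq).sqrt (by positivity)
        simp only [Real.sqrt_sq (norm_nonneg _)] at h2
        refine h2.congr_deriv ?_
        rw [he, real_inner_smul_right, real_inner_comm]
        field_simp
      have hns := (hasDerivAt_iff_tendsto_slope_left_right.1 hnorm).2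
      have hcc : Tendsto (fun s => ⟪c s, e⟫) (nhdsWithin t (Ioi t)) (nhds ‖c t‖) := by
        rw [← hce]
        exact ((hc.continuousAt.inner continuousAt_const).tendsto).mono_left nhdsWithin_le_nhds
      have hslopein : Tendsto (fun s => ⟪slope c t s, e⟫) (nhdsWithin t (Ioi t)) (nhds ⟪v, e⟫) :=
        hcs.inner tendsto_const_nhds
      set τ : ℝ → ℝ := fun s => √(‖slope c t s‖ ^ 2 - ⟪slope c t s, e⟫ ^ 2) / ⟪c s, e⟫ with hτ
      have hτlim : Tendsto τ (nhdsWithin t (Ioi t))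
          (nhds (√(‖v‖ ^ 2 - ⟪v, e⟫ ^ 2) / ‖c t‖)) :=
        (((hcs.norm.pow 2).sub (hslopein.pow 2)).sqrt).div hcc hxp.ne'
      have hst0 : Tendsto (fun s => s - t) (nhdsWithin t (Ioi t)) (nhds 0) := by
        have : Tendsto (fun s => s - t) (nhds t) (nhds (t - t)) := tendsto_id.sub_const t
        rw [sub_self] at this
        exact this.mono_left nhdsWithin_le_nhds
      have hlim : Tendsto (fun s => √(slope (fun s => ‖c s‖) t s ^ 2 + (G ‖c t‖ * τ s) ^ 2) +
          m * G ‖c t‖ * (τ s ^ 2 * (s - t))) (nhdsWithin t (Ioi t))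
          (nhds (√(⟪v, e⟫ ^ 2 + (G ‖c t‖ * (√(‖v‖ ^ 2 - ⟪v, e⟫ ^ 2) / ‖c t‖)) ^ 2) +
            m * G ‖c t‖ * ((√(‖v‖ ^ 2 - ⟪v, e⟫ ^ 2) / ‖c t‖) ^ 2 * 0))) :=
        (((hns.pow 2).add ((hτlim.const_mul _).pow 2)).sqrt).add
          (((hτlim.pow 2).mul hst0).const_mul _)
      have hval : √(⟪v, e⟫ ^ 2 + (G ‖c t‖ * (√(‖v‖ ^ 2 - ⟪v, e⟫ ^ 2) / ‖c t‖)) ^ 2) +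
            m * G ‖c t‖ * ((√(‖v‖ ^ 2 - ⟪v, e⟫ ^ 2) / ‖c t‖) ^ 2 * 0) =
          √(⟪v, e⟫ ^ 2 + (G ‖c t‖ / ‖c t‖) ^ 2 * (‖v‖ ^ 2 - ⟪v, e⟫ ^ 2)) := by
        rw [mul_zero, mul_zero, add_zero, mul_pow, div_pow, div_pow,
          Real.sq_sqrt (norm_sq_sub_inner_sq_nonneg (c t) v)]
        congr 2
        ring
      rw [hval] at hlim
      refine le_of_tendsto_of_tendsto hws hlim ?_
      filter_upwards [self_mem_nhdsWithin, hcc.eventually (lt_mem_nhds hxp)] with s hs hpos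
      have hst : 0 < s - t := sub_pos.2 hs
      have hcs' : c s = c t + (s - t) • slope c t s := by
        rw [slope_def_module, smul_inv_smul₀ hst.ne', add_sub_cancel]
      have hperp : ‖c s‖ ^ 2 - ⟪c s, e⟫ ^ 2 =
          (s - t) ^ 2 * (‖slope c t s‖ ^ 2 - ⟪slope c t s, e⟫ ^ 2) := by
        have hct : c t = ‖c t‖ • e := by rw [he, smul_inv_smul₀ hxp.ne']
        have hee : ⟪e, e⟫ = 1 := by
          rw [he, real_inner_smul_left, ← he, hce]; field_simp
        rw [hcs', ← real_inner_self_eq_norm_sq, ← real_inner_self_eq_norm_sq]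
        rw [hct]
        simp only [inner_add_left, inner_add_right, real_inner_smul_left, real_inner_smul_right, hee,
          real_inner_comm (slope c t s) e]
        ring
      have hang : angle (c t) (c s) ≤ τ s * (s - t) := by
        refine (angle_le_sqrt_div hx0 hpos).trans (le_of_eq ?_)
        rw [← he, hperp, Real.sqrt_mul (sq_nonneg _), Real.sqrt_sq hst.le, hτ]
        ring
      have hinc := h1 (c t) (c s) hx0 _ hang
      rw [slope_def_field, div_le_iff₀ hst]
      refine hinc.trans (le_of_eq ?_)
      rw [slope_def_field, add_mul]
      congr 1
      · rw [show (‖c s‖ - ‖c t‖) ^ 2 + (G ‖c t‖ * (τ s * (s - t))) ^ 2 =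
          (((‖c s‖ - ‖c t‖) / (s - t)) ^ 2 + (G ‖c t‖ * τ s) ^ 2) * (s - t) ^ 2 by
            field_simp, Real.sqrt_mul (by positivity), Real.sqrt_sq hst.le]
      · ring

theorem sub_le_sub_of_hasDerivAt_le {F K F' K' : ℝ → ℝ} {a b : ℝ} (hab : a ≤ b)
    (hF : ∀ t ∈ Icc a b, HasDerivAt F (F' t) t) (hK : ∀ t ∈ Icc a b, HasDerivAt K (K' t) t)
    (hle : ∀ t ∈ Icc a b, F' t ≤ K' t) : F b - F a ≤ K b - K a := by
  have hm : MonotoneOn (K - F) (Icc a b) := by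
    refine monotoneOn_of_deriv_nonneg (convex_Icc a b) ?_ ?_ ?_
    · exact fun t ht => ((hK t ht).sub (hF t ht)).continuousAt.continuousWithinAt
    · exact fun t ht =>
        ((hK t (interior_subset ht)).sub (hF t (interior_subset ht))).differentiableAt.differentiableWithinAt
    · intro t ht
      have ht := interior_subset ht
      rw [((hK t ht).sub (hF t ht)).deriv]
      linarith [hle t ht]
  have := hm (left_mem_Icc.2 hab) (right_mem_Icc.2 hab) hab
  simp only [Pi.sub_apply] at this
  linarith

/-- The defect of the length function `ρ χ * sin (χ + ε)` along an extremal. -/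
def lengthDefect (g g₁ ρ : ℝ → ℝ) (χ₀ ε χ : ℝ) : ℝ :=
  ∫ t in χ₀..χ, Real.cos (t + ε) * (ρ t - g (ρ t) / g₁ (ρ t))

namespace IsExtremal

variable {g g₁ H : ℝ → ℝ} {χ₀ χ₁ : ℝ} {ρ φ : ℝ → ℝ}

theorem left_mem_Ioo (E : IsExtremal g g₁ χ₀ χ₁ ρ φ) :
    χ₀ ∈ Ioo (-(Real.pi / 2)) (Real.pi / 2) := E.mem_Ioo (left_mem_Icc.2 E.lt.le)

theorem hasDerivAt_lengthDefect (E : IsExtremal g g₁ χ₀ χ₁ ρ φ) (h : IsRadialProfile g g₁ H)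
    (ε : ℝ) {χ : ℝ} (hχ : χ ∈ Ioo (-(Real.pi / 2)) (Real.pi / 2)) :
    HasDerivAt (lengthDefect g g₁ ρ χ₀ ε) (Real.cos (χ + ε) * (ρ χ - g (ρ χ) / g₁ (ρ χ))) χ := by
  have hc : ContinuousOn (fun t => Real.cos (t + ε) * (ρ t - g (ρ t) / g₁ (ρ t)))
      (Ioo (-(Real.pi / 2)) (Real.pi / 2)) := by
    refine ContinuousOn.mul (by fun_prop) (E.continuousOn_radius.sub (ContinuousOn.div ?_ ?_ ?_))
    · exact h.continuous.comp_continuousOn E.continuousOn_radius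
    · exact h.continuous_deriv.comp_continuousOn E.continuousOn_radius
    · exact fun t _ => (h.pos_deriv _).ne'
  exact intervalIntegral.integral_hasDerivAt_right
    (hc.mono (ordConnected_Ioo.uIcc_subset E.left_mem_Ioo hχ)).intervalIntegrable
    (hc.stronglyMeasurableAtFilter isOpen_Ioo χ hχ) (hc.continuousAt (isOpen_Ioo.mem_nhds hχ))

theorem lengthDefect_nonneg (h : IsRadialProfile g g₁ H)
    {ε : ℝ} (hε : ∀ t ∈ Icc χ₀ χ₁, 0 ≤ Real.cos (t + ε)) {χ : ℝ} (hχ : χ ∈ Icc χ₀ χ₁) :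
    0 ≤ lengthDefect g g₁ ρ χ₀ ε χ :=
  intervalIntegral.integral_nonneg hχ.1 fun t ht =>
    mul_nonneg (hε t ⟨ht.1, ht.2.trans hχ.2⟩) (h.sub_div_nonneg _)

theorem exists_sub_le_mul_sub (E : IsExtremal g g₁ χ₀ χ₁ ρ φ) (h : IsRadialProfile g g₁ H) :
    ∃ m, 0 ≤ m ∧ ∀ χ χ', χ₀ ≤ χ → χ ≤ χ' → χ' ≤ χ₁ → χ' - χ ≤ m * (φ χ' - φ χ) := by
  obtain ⟨m, hm⟩ : ∃ m, ∀ t ∈ Icc χ₀ χ₁, g₁ (ρ t) ≤ m := by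
    have hc : ContinuousOn (fun t => g₁ (ρ t)) (Icc χ₀ χ₁) :=
      h.continuous_deriv.comp_continuousOn (E.continuousOn_radius.mono fun t ht => E.mem_Ioo ht)
    obtain ⟨m, hm⟩ := (isCompact_Icc.image_of_continuousOn hc).bddAbove
    exact ⟨m, fun t ht => hm ⟨t, ht, rfl⟩⟩
  refine ⟨m, (h.pos_deriv _).le.trans (hm χ₀ (left_mem_Icc.2 E.lt.le)), ?_⟩
  intro χ χ' h0 hle h1
  have hmem : ∀ t ∈ Icc χ χ', t ∈ Icc χ₀ χ₁ := fun t ht => ⟨h0.trans ht.1, ht.2.trans h1⟩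
  rw [mul_sub]
  refine sub_le_sub_of_hasDerivAt_le (F := fun t => t) (K := fun t => m * φ t) hle
    (fun t _ => hasDerivAt_id t)
    (fun t ht => (E.hasDerivAt_angle t (E.mem_Ioo (hmem t ht))).const_mul m) fun t ht => ?_
  rw [mul_one_div, le_div_iff₀ (h.pos_deriv _), one_mul]
  exact hm t (hmem t ht)

theorem support_sub_le (E : IsExtremal g g₁ χ₀ χ₁ ρ φ) (h : IsRadialProfile g g₁ H)
    {ε : ℝ} (hε : ∀ t ∈ Icc χ₀ χ₁, 0 ≤ Real.cos (t + ε)) {r χ χ' : ℝ} (hr : 0 ≤ r)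
    (hχ : χ₀ ≤ χ) (hle : χ ≤ χ') (hχ' : χ' ≤ χ₁) :
    (r * Real.sin (χ' + ε) - lengthDefect g g₁ ρ χ₀ ε χ') -
      (r * Real.sin (χ + ε) - lengthDefect g g₁ ρ χ₀ ε χ) ≤
      g r * (Real.cos (χ' + ε) + (χ' - χ)) * (φ χ' - φ χ) := by
  have hmem : ∀ t ∈ Icc χ χ', t ∈ Icc χ₀ χ₁ := fun t ht => ⟨hχ.trans ht.1, ht.2.trans hχ'⟩
  rw [mul_sub (g r * (Real.cos (χ' + ε) + (χ' - χ)))]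
  refine sub_le_sub_of_hasDerivAt_le
    (F := fun t => r * Real.sin (t + ε) - lengthDefect g g₁ ρ χ₀ ε t)
    (K := fun t => g r * (Real.cos (χ' + ε) + (χ' - χ)) * φ t) hle
    (fun t ht => ((((hasDerivAt_id t).add_const ε).sin).const_mul r).sub
      (E.hasDerivAt_lengthDefect h ε (E.mem_Ioo (hmem t ht))))
    (fun t ht => (E.hasDerivAt_angle t (E.mem_Ioo (hmem t ht))).const_mul _) ?_
  intro t ht
  have hc := hε t (hmem t ht)
  have h1 := mul_le_mul_of_nonneg_left (h.sub_add_div_le r (ρ t)) hc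
  have h2 : Real.cos (t + ε) ≤ Real.cos (χ' + ε) + (χ' - χ) := by
    have h3 := Real.lipschitzWith_cos.dist_le_mul (t + ε) (χ' + ε)
    rw [Real.dist_eq, Real.dist_eq, NNReal.coe_one, one_mul] at h3
    have h4 : |t + ε - (χ' + ε)| = χ' - t := by
      rw [abs_sub_comm, abs_of_nonneg (by linarith [ht.2])]; ring
    linarith [le_abs_self (Real.cos (t + ε) - Real.cos (χ' + ε)), ht.1]
  have h5 : 0 ≤ g r / g₁ (ρ t) := div_nonneg (h.nonneg hr) (h.pos_deriv _).le
  have h6 := mul_le_mul_of_nonneg_right h2 h5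
  have h7 : g r * (Real.cos (χ' + ε) + (χ' - χ)) * (1 / g₁ (ρ t)) =
    (Real.cos (χ' + ε) + (χ' - χ)) * (g r / g₁ (ρ t)) := by ring
  rw [h7]
  simp only [id]
  linarith

theorem le_dist_of_le_angle {n : ℕ} {p : M} {G : ℝ → ℝ} {Φ : Euc n ≃ M}
    (hsym : IsSphericallySymmetric p G Φ) (h : IsRadialProfile g g₁ H)
    (hgG : ∀ r, 0 < r → g r = G r) (E : IsExtremal g g₁ χ₀ χ₁ ρ φ) (hφ : φ χ₀ = 0)
    {ε : ℝ} (hε : ∀ t ∈ Icc χ₀ χ₁, 0 ≤ Real.cos (t + ε)) (u z : Euc n) {χ : ℝ}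
    (hχ : χ ∈ Icc χ₀ χ₁) (hz : φ χ ≤ angle u z) (hu : ‖u‖ = 1) :
    ‖z‖ * Real.sin (χ + ε) - lengthDefect g g₁ ρ χ₀ ε χ - ρ χ₀ * Real.sin (χ₀ + ε) ≤
      dist (Φ (ρ χ₀ • u)) (Φ z) := by
  set s : ℝ → ℝ → ℝ := fun r χ => r * Real.sin (χ + ε) - lengthDefect g g₁ ρ χ₀ ε χ with hs
  set S : ℝ → ℝ → ℝ := fun r ψ => sSup (s r '' {χ | χ ∈ Icc χ₀ χ₁ ∧ φ χ ≤ ψ}) with hS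
  have hleft : χ₀ ∈ Icc χ₀ χ₁ := left_mem_Icc.2 E.lt.le
  have hsr : ∀ r, 0 ≤ r → ∀ χ ∈ Icc χ₀ χ₁, s r χ ≤ r := fun r hr χ hχ => by
    have h1 := lengthDefect_nonneg (ρ := ρ) h hε hχ
    have h2 := mul_le_mul_of_nonneg_left (Real.sin_le_one (χ + ε)) hr
    simp only [hs]; linarith
  have hbdd : ∀ r, 0 ≤ r → ∀ ψ, BddAbove (s r '' {χ | χ ∈ Icc χ₀ χ₁ ∧ φ χ ≤ ψ}) := by
    rintro r hr ψ
    refine ⟨r, ?_⟩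
    rintro _ ⟨χ, hχ, rfl⟩
    exact hsr r hr χ hχ.1
  have hne : ∀ r ψ, 0 ≤ ψ → (s r '' {χ | χ ∈ Icc χ₀ χ₁ ∧ φ χ ≤ ψ}).Nonempty := fun r ψ hψ =>
    ⟨_, χ₀, ⟨hleft, hφ.le.trans hψ⟩, rfl⟩
  have hleS : ∀ r, 0 ≤ r → ∀ ψ, ∀ χ ∈ Icc χ₀ χ₁, φ χ ≤ ψ → s r χ ≤ S r ψ := fun r hr ψ χ hχ hψ =>
    le_csSup (hbdd r hr ψ) ⟨χ, ⟨hχ, hψ⟩, rfl⟩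
  obtain ⟨m, hm0, hφm⟩ := E.exists_sub_le_mul_sub h
  have hinc : ∀ r r' ψ ψ' δ, 0 ≤ r → 0 ≤ ψ → 0 ≤ ψ' → ψ' ≤ ψ + δ → 0 ≤ δ →
      S r' ψ' - S r ψ ≤ √((r' - r) ^ 2 + (g r * δ) ^ 2) + m * g r * δ ^ 2 := by
    intro r r' ψ ψ' δ hr hψ hψ' hψδ hδ
    have hg := h.nonneg hr
    rw [sub_le_iff_le_add]
    refine csSup_le (hne r' ψ' hψ') ?_
    rintro _ ⟨χ', ⟨hχ', hφχ'⟩, rfl⟩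
    have hsub : s r' χ' = s r χ' + (r' - r) * Real.sin (χ' + ε) := by simp only [hs]; ring
    have hcs : ∀ δ', 0 ≤ δ' → δ' ≤ δ → (r' - r) * Real.sin (χ' + ε) + g r * δ' * Real.cos (χ' + ε) ≤
        √((r' - r) ^ 2 + (g r * δ) ^ 2) := by
      intro δ' h0 h1
      have h2 : (g r * δ') ^ 2 ≤ (g r * δ) ^ 2 :=
        pow_le_pow_left₀ (mul_nonneg hg h0) (mul_le_mul_of_nonneg_left h1 hg) 2
      refine (Real.le_sqrt_of_sq_le ?_).trans (Real.sqrt_le_sqrt (by linarith :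
        (r' - r) ^ 2 + (g r * δ') ^ 2 ≤ _))
      nlinarith [sq_nonneg ((r' - r) * Real.cos (χ' + ε) - g r * δ' * Real.sin (χ' + ε)),
        Real.sin_sq_add_cos_sq (χ' + ε)]
    by_cases hcase : φ χ' ≤ ψ
    · have h1 := hleS r hr ψ χ' hχ' hcase
      have h2 := hcs 0 le_rfl hδ
      have h3 : 0 ≤ m * g r * δ ^ 2 := by positivity
      rw [mul_zero, zero_mul, add_zero] at h2
      linarith
    · rw [not_le] at hcase
      obtain ⟨χ, hχ, hφχ⟩ := intermediate_value_Icc hχ'.1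
        (E.continuousOn_angle.mono (Icc_subset_Icc_right hχ'.2))
        (show ψ ∈ Icc (φ χ₀) (φ χ') from ⟨hφ.le.trans hψ, hcase.le⟩)
      have h1 := hleS r hr ψ χ ⟨hχ.1, hχ.2.trans hχ'.2⟩ hφχ.le
      have h2 := E.support_sub_le h hε hr hχ.1 hχ.2 hχ'.2
      have h3 := hφm χ χ' hχ.1 hχ.2 hχ'.2
      have hd0 : 0 ≤ φ χ' - φ χ := by linarith
      have hd1 : φ χ' - φ χ ≤ δ := by linarith
      have h4 := hcs _ hd0 hd1
      have h5 : g r * (χ' - χ) * (φ χ' - φ χ) ≤ g r * (m * δ) * δ := by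
        have : χ' - χ ≤ m * δ := h3.trans (mul_le_mul_of_nonneg_left hd1 hm0)
        gcongr
      simp only [hs] at hsub h1 ⊢
      nlinarith
  have hmain := sub_le_dist_of_increment hsym (h := fun y => S ‖y‖ (angle u y)) hm0
    ?_ ?_ ?_ (ρ χ₀ • u) z
  · have hρ := E.pos χ₀ E.left_mem_Ioo
    have h1 := hleS ‖z‖ (norm_nonneg z) _ χ hχ hz
    have h2 : S ‖ρ χ₀ • u‖ (angle u (ρ χ₀ • u)) ≤ s (ρ χ₀) χ₀ := by
      rw [angle_smul_right_of_pos _ _ hρ, angle_self (by rintro rfl; simp at hu), norm_smul, hu,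
        mul_one, Real.norm_of_nonneg hρ.le]
      refine csSup_le (hne _ _ le_rfl) ?_
      rintro _ ⟨χ, ⟨hχ, hφχ⟩, rfl⟩
      have : χ = χ₀ := by
        refine le_antisymm (not_lt.1 fun hlt => ?_) hχ.1
        have := E.strictMonoOn_angle h E.left_mem_Ioo (E.mem_Ioo hχ) hlt
        linarith
      rw [this]
    have h3 : s (ρ χ₀) χ₀ = ρ χ₀ * Real.sin (χ₀ + ε) := by
      simp only [hs, lengthDefect, intervalIntegral.integral_same, sub_zero]
    simp only [hs] at h1 h3
    simp only [hs] at h2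
    linarith
  · intro R
    obtain ⟨K, hK⟩ := (isCompact_Icc (a := (0 : ℝ)) (b := R)).image h.continuous_deriv |>.bddAbove
    refine ⟨K, fun r hr hrR => ?_⟩
    have h1 := h.tangent_le 0 r
    rw [h.map_zero] at h1
    rw [← hgG r hr]
    have h2 : g₁ r ≤ K := hK ⟨r, ⟨hr.le, hrR⟩, rfl⟩
    nlinarith
  · intro y
    have h1 : S ‖y‖ (angle u y) ≤ ‖y‖ := by
      refine csSup_le (hne _ _ (angle_nonneg _ _)) ?_
      rintro _ ⟨χ, ⟨hχ, -⟩, rfl⟩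
      exact hsr _ (norm_nonneg y) χ hχ
    have h2 := hleS ‖(0 : Euc n)‖ (norm_nonneg _) (angle u 0) χ₀ hleft (hφ.le.trans (angle_nonneg _ _))
    have h3 : s ‖(0 : Euc n)‖ χ₀ = 0 := by simp [hs, lengthDefect]
    linarith
  · intro x y hx δ hδ
    rw [← hgG _ (norm_pos_iff.2 hx)]
    refine hinc ‖x‖ ‖y‖ _ _ δ (norm_nonneg x) (angle_nonneg _ _) (angle_nonneg _ _) ?_
      ((angle_nonneg _ _).trans hδ)
    exact (angle_le_angle_add_angle u x y).trans (by linarith)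

end IsExtremal

/-- Constant speed parametrization of the arc from `u` to `v`, where `α` is their angle. -/
def slerp {n : ℕ} (u v : Euc n) (α β : ℝ) : Euc n :=
  (Real.sin (α - β) / Real.sin α) • u + (Real.sin β / Real.sin α) • v

section slerp

variable {n : ℕ} {u v : Euc n} {α : ℝ}

theorem slerp_swap (u v : Euc n) (α β : ℝ) : slerp v u α (α - β) = slerp u v α β := by
  simp only [slerp]
  rw [show α - (α - β) = β by ring, add_comm]

theorem slerp_zero (hα : Real.sin α ≠ 0) : slerp u v α 0 = u := by
  simp [slerp, hα]

theorem slerp_right (hα : Real.sin α ≠ 0) : slerp u v α α = v := by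
  simp [slerp, hα]

theorem inner_left_slerp (hu : ‖u‖ = 1) (huv : ⟪u, v⟫ = Real.cos α)
    (hα : Real.sin α ≠ 0) (β : ℝ) : ⟪u, slerp u v α β⟫ = Real.cos β := by
  rw [slerp, inner_add_right, real_inner_smul_right, real_inner_smul_right, huv,
    real_inner_self_eq_norm_sq, hu, Real.sin_sub]
  field_simp
  ring

theorem inner_right_slerp (hv : ‖v‖ = 1) (huv : ⟪u, v⟫ = Real.cos α)
    (hα : Real.sin α ≠ 0) (β : ℝ) : ⟪v, slerp u v α β⟫ = Real.cos (α - β) := by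
  rw [← slerp_swap, inner_left_slerp hv (by rw [real_inner_comm, huv]) hα]

theorem norm_slerp (hu : ‖u‖ = 1) (hv : ‖v‖ = 1) (huv : ⟪u, v⟫ = Real.cos α)
    (hα : Real.sin α ≠ 0) (β : ℝ) : ‖slerp u v α β‖ = 1 := by
  have h : ‖slerp u v α β‖ ^ 2 = 1 := by
    rw [← real_inner_self_eq_norm_sq]
    nth_rewrite 1 [slerp]
    rw [inner_add_left, real_inner_smul_left, real_inner_smul_left, inner_left_slerp hu huv hα,
      inner_right_slerp hv huv hα, div_mul_eq_mul_div, div_mul_eq_mul_div, ← add_div,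
      show Real.sin (α - β) * Real.cos β + Real.sin β * Real.cos (α - β) = Real.sin α by
        rw [mul_comm (Real.sin β), ← Real.sin_add, sub_add_cancel], div_self hα]
  exact (pow_eq_one_iff_of_nonneg (norm_nonneg _) two_ne_zero).1 h

theorem eq_slerp (hu : ‖u‖ = 1) (hv : ‖v‖ = 1) (huv : ⟪u, v⟫ = Real.cos α)
    (hα : Real.sin α ≠ 0) {β : ℝ} {w : Euc n} (hw : ‖w‖ = 1) (h1 : ⟪u, w⟫ = Real.cos β)
    (h2 : ⟪v, w⟫ = Real.cos (α - β)) : w = slerp u v α β := by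
  rw [← inner_eq_one_iff_of_norm_eq_one (𝕜 := ℝ) hw (norm_slerp hu hv huv hα β), real_inner_comm, slerp,
    inner_add_left, real_inner_smul_left, real_inner_smul_left, h1, h2, div_mul_eq_mul_div,
    div_mul_eq_mul_div, ← add_div,
    show Real.sin (α - β) * Real.cos β + Real.sin β * Real.cos (α - β) = Real.sin α by
      rw [mul_comm (Real.sin β), ← Real.sin_add, sub_add_cancel], div_self hα]

/-- The velocity of `slerp`. -/
def slerpDeriv {n : ℕ} (u v : Euc n) (α β : ℝ) : Euc n :=
  (-Real.cos (α - β) / Real.sin α) • u + (Real.cos β / Real.sin α) • v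

theorem hasDerivAt_slerp (u v : Euc n) (α β : ℝ) :
    HasDerivAt (slerp u v α) (slerpDeriv u v α β) β := by
  have h1 : HasDerivAt (fun β => Real.sin (α - β) / Real.sin α)
      (-Real.cos (α - β) / Real.sin α) β := by
    refine ((((hasDerivAt_id β).const_sub α).sin).div_const _).congr_deriv ?_
    simp only [id]; ring
  exact (h1.smul_const u).add (((Real.hasDerivAt_sin β).div_const _).smul_const v)

theorem inner_slerp_slerpDeriv (hu : ‖u‖ = 1) (hv : ‖v‖ = 1) (huv : ⟪u, v⟫ = Real.cos α)
    (hα : Real.sin α ≠ 0) (β : ℝ) : ⟪slerp u v α β, slerpDeriv u v α β⟫ = 0 := by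
  rw [slerpDeriv, inner_add_right, real_inner_smul_right, real_inner_smul_right, real_inner_comm,
    inner_left_slerp hu huv hα, real_inner_comm, inner_right_slerp hv huv hα]
  ring

theorem norm_slerpDeriv (hu : ‖u‖ = 1) (hv : ‖v‖ = 1) (huv : ⟪u, v⟫ = Real.cos α)
    (hα : Real.sin α ≠ 0) (β : ℝ) : ‖slerpDeriv u v α β‖ = 1 := by
  have h : ‖slerpDeriv u v α β‖ ^ 2 = 1 := by
    have huu : ⟪u, u⟫ = 1 := by rw [real_inner_self_eq_norm_sq, hu, one_pow]
    have hvv : ⟪v, v⟫ = 1 := by rw [real_inner_self_eq_norm_sq, hv, one_pow]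
    have hvu : ⟪v, u⟫ = Real.cos α := by rw [real_inner_comm, huv]
    rw [← real_inner_self_eq_norm_sq, slerpDeriv]
    simp only [inner_add_left, inner_add_right, real_inner_smul_left, real_inner_smul_right, huv,
      hvu, huu, hvv]
    have h1 := Real.cos_sub α β
    have h2 := Real.sin_sq_add_cos_sq α
    have h3 := Real.sin_sq_add_cos_sq β
    rw [h1]
    field_simp
    linear_combination Real.sin α ^ 2 * h3 - Real.cos β ^ 2 * h2
  exact (pow_eq_one_iff_of_nonneg (norm_nonneg _) two_ne_zero).1 h

end slerp

theorem warpNorm_smul_add {n : ℕ} (G : ℝ → ℝ) {r : ℝ} (hr : 0 < r) {d d' : Euc n} (hd : ‖d‖ = 1)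
    (hd' : ‖d'‖ = 1) (hdd : ⟪d, d'⟫ = 0) (a b : ℝ) :
    warpNorm G (r • d) (a • d + b • d') = √(a ^ 2 + (G r / r * b) ^ 2) := by
  have hn : ‖r • d‖ = r := by rw [norm_smul, hd, mul_one, Real.norm_of_nonneg hr.le]
  have h0 : r • d ≠ 0 := by rw [← norm_pos_iff, hn]; exact hr
  have hd'd : ⟪d', d⟫ = 0 := by rw [real_inner_comm, hdd]
  have h1 : ⟪a • d + b • d', r⁻¹ • r • d⟫ = a := by
    rw [inv_smul_smul₀ hr.ne', inner_add_left, real_inner_smul_left, real_inner_smul_left, hd'd,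
      real_inner_self_eq_norm_sq, hd]
    ring
  have h2 : ‖a • d + b • d'‖ ^ 2 = a ^ 2 + b ^ 2 := by
    have h3 : ⟪d, d⟫ = 1 := by rw [real_inner_self_eq_norm_sq, hd, one_pow]
    have h4 : ⟪d', d'⟫ = 1 := by rw [real_inner_self_eq_norm_sq, hd', one_pow]
    rw [← real_inner_self_eq_norm_sq]
    simp only [inner_add_left, inner_add_right, real_inner_smul_left, real_inner_smul_right, hdd,
      hd'd, h3, h4]
    ring
  rw [warpNorm, if_neg h0, hn, h1, h2]
  congr 1
  ring

namespace IsExtremal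

variable {g g₁ H : ℝ → ℝ} {χ₀ χ₁ : ℝ} {ρ φ A : ℝ → ℝ}

theorem exists_arclength (E : IsExtremal g g₁ χ₀ χ₁ ρ φ) (h : IsRadialProfile g g₁ H) :
    ∃ A : ℝ → ℝ, ∀ χ ∈ Ioo (-(Real.pi / 2)) (Real.pi / 2),
      HasDerivAt A (g (ρ χ) / (g₁ (ρ χ) * Real.cos χ)) χ := by
  refine ⟨fun χ => ρ χ * Real.sin χ - lengthDefect g g₁ ρ χ₀ 0 χ, fun χ hχ => ?_⟩
  have hcos := (Real.cos_pos_of_mem_Ioo hχ).ne'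
  have hg := (h.pos_deriv (ρ χ)).ne'
  refine (((E.hasDerivAt_radius χ hχ).mul (Real.hasDerivAt_sin χ)).sub
    (E.hasDerivAt_lengthDefect h 0 hχ)).congr_deriv ?_
  rw [Real.tan_eq_sin_div_cos, add_zero]
  field_simp
  linear_combination g (ρ χ) * Real.sin_sq_add_cos_sq χ

theorem reverse_arclength
    (hA : ∀ χ ∈ Ioo (-(Real.pi / 2)) (Real.pi / 2),
      HasDerivAt A (g (ρ χ) / (g₁ (ρ χ) * Real.cos χ)) χ) :
    ∀ χ ∈ Ioo (-(Real.pi / 2)) (Real.pi / 2), HasDerivAt (fun χ => -A (-χ))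
      (g (ρ (-χ)) / (g₁ (ρ (-χ)) * Real.cos χ)) χ := by
  intro χ hχ
  refine (((hA (-χ) ⟨by linarith [hχ.2], by linarith [hχ.1]⟩).comp χ
    (hasDerivAt_neg χ)).neg).congr_deriv ?_
  rw [Real.cos_neg]
  ring

theorem support_eq (E : IsExtremal g g₁ χ₀ χ₁ ρ φ) (h : IsRadialProfile g g₁ H)
    (hA : ∀ χ ∈ Ioo (-(Real.pi / 2)) (Real.pi / 2),
      HasDerivAt A (g (ρ χ) / (g₁ (ρ χ) * Real.cos χ)) χ) (ε : ℝ) {χ : ℝ} (hχ : χ ∈ Icc χ₀ χ₁) :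
    ρ χ * Real.sin (χ + ε) - lengthDefect g g₁ ρ χ₀ ε χ - ρ χ₀ * Real.sin (χ₀ + ε) =
      Real.cos ε * (A χ - A χ₀) := by
  have hmem : ∀ t ∈ Icc χ₀ χ, t ∈ Ioo (-(Real.pi / 2)) (Real.pi / 2) := fun t ht =>
    E.mem_Ioo ⟨ht.1, ht.2.trans hχ.2⟩
  have h1 : ∀ t ∈ Icc χ₀ χ,
      HasDerivAt (fun t => ρ t * Real.sin (t + ε) - lengthDefect g g₁ ρ χ₀ ε t)
        (Real.cos ε * (g (ρ t) / (g₁ (ρ t) * Real.cos t))) t := fun t ht => by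
    have hcos := (Real.cos_pos_of_mem_Ioo (hmem t ht)).ne'
    have hg := (h.pos_deriv (ρ t)).ne'
    refine (((E.hasDerivAt_radius t (hmem t ht)).mul (((hasDerivAt_id t).add_const ε).sin)).sub
      (E.hasDerivAt_lengthDefect h ε (hmem t ht))).congr_deriv ?_
    simp only [id]
    rw [Real.tan_eq_sin_div_cos, Real.sin_add, Real.cos_add]
    field_simp
    linear_combination (g (ρ t) * Real.cos ε) * Real.sin_sq_add_cos_sq t
  have h2 : ∀ t ∈ Icc χ₀ χ, HasDerivAt (fun t => Real.cos ε * A t)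
      (Real.cos ε * (g (ρ t) / (g₁ (ρ t) * Real.cos t))) t := fun t ht =>
    (hA t (hmem t ht)).const_mul _
  have h3 := sub_le_sub_of_hasDerivAt_le hχ.1 h1 h2 fun _ _ => le_rfl
  have h4 := sub_le_sub_of_hasDerivAt_le hχ.1 h2 h1 fun _ _ => le_rfl
  have h5 : lengthDefect g g₁ ρ χ₀ ε χ₀ = 0 := intervalIntegral.integral_same
  simp only [h5] at h3 h4
  linarith

theorem dist_curve_le {n : ℕ} {p : M} {G : ℝ → ℝ} {Φ : Euc n ≃ M}
    (hsym : IsSphericallySymmetric p G Φ) (h : IsRadialProfile g g₁ H)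
    (hgG : ∀ r, 0 < r → g r = G r) (E : IsExtremal g g₁ χ₀ χ₁ ρ φ)
    (hA : ∀ χ ∈ Ioo (-(Real.pi / 2)) (Real.pi / 2),
      HasDerivAt A (g (ρ χ) / (g₁ (ρ χ) * Real.cos χ)) χ)
    {u v : Euc n} {α : ℝ} (hu : ‖u‖ = 1) (hv : ‖v‖ = 1) (huv : ⟪u, v⟫ = Real.cos α)
    (hα : Real.sin α ≠ 0) {χ χ' : ℝ} (h0 : χ₀ ≤ χ) (hle : χ ≤ χ') (h1 : χ' ≤ χ₁) :
    dist (Φ (ρ χ • slerp u v α (φ χ))) (Φ (ρ χ' • slerp u v α (φ χ'))) ≤ A χ' - A χ := by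
  have hmem : ∀ τ ∈ Icc 0 (χ' - χ), χ + τ ∈ Ioo (-(Real.pi / 2)) (Real.pi / 2) := fun τ hτ =>
    E.mem_Ioo ⟨by linarith [hτ.1], by linarith [hτ.2]⟩
  set B : ℝ → ℝ := fun τ => g (ρ (χ + τ)) / (g₁ (ρ (χ + τ)) * Real.cos (χ + τ)) with hB
  have hBpos : ∀ τ ∈ Icc 0 (χ' - χ), 0 ≤ B τ := fun τ hτ =>
    div_nonneg (h.nonneg (E.pos _ (hmem τ hτ)).le)
      (mul_nonneg (h.pos_deriv _).le (Real.cos_pos_of_mem_Ioo (hmem τ hτ)).le)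
  have hBc : ContinuousOn B (Icc 0 (χ' - χ)) := by
    have hρc : ContinuousOn (fun τ => ρ (χ + τ)) (Icc 0 (χ' - χ)) :=
      E.continuousOn_radius.comp (by fun_prop) hmem
    refine ContinuousOn.div (h.continuous.comp_continuousOn hρc)
      ((h.continuous_deriv.comp_continuousOn hρc).mul (by fun_prop)) fun τ hτ => ?_
    exact (mul_pos (h.pos_deriv _) (Real.cos_pos_of_mem_Ioo (hmem τ hτ))).ne'
  have hcd : ∀ τ ∈ Icc 0 (χ' - χ), HasDerivAt
      (fun τ => ρ (χ + τ) • slerp u v α (φ (χ + τ)))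
      ((g (ρ (χ + τ)) * Real.tan (χ + τ) / g₁ (ρ (χ + τ))) • slerp u v α (φ (χ + τ)) +
        (ρ (χ + τ) * (1 / g₁ (ρ (χ + τ)))) • slerpDeriv u v α (φ (χ + τ))) τ := fun τ hτ => by
    have h2 := (E.hasDerivAt_radius _ (hmem τ hτ)).comp_const_add χ τ
    have h3 := (E.hasDerivAt_angle _ (hmem τ hτ)).comp_const_add χ τ
    have h4 := (hasDerivAt_slerp u v α (φ (χ + τ))).scomp τ h3
    refine (h2.smul h4).congr_deriv ?_
    simp only [Function.comp]
    rw [smul_smul, add_comm]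
  have hwn : ∀ τ ∈ Icc 0 (χ' - χ), warpNorm G (ρ (χ + τ) • slerp u v α (φ (χ + τ)))
      ((g (ρ (χ + τ)) * Real.tan (χ + τ) / g₁ (ρ (χ + τ))) • slerp u v α (φ (χ + τ)) +
        (ρ (χ + τ) * (1 / g₁ (ρ (χ + τ)))) • slerpDeriv u v α (φ (χ + τ))) = B τ := fun τ hτ => by
    have hρ := E.pos _ (hmem τ hτ)
    have hcos := (Real.cos_pos_of_mem_Ioo (hmem τ hτ)).ne'
    have hg := (h.pos_deriv (ρ (χ + τ))).ne'
    rw [warpNorm_smul_add G hρ (norm_slerp hu hv huv hα _) (norm_slerpDeriv hu hv huv hα _)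
      (inner_slerp_slerpDeriv hu hv huv hα _), ← hgG _ hρ, ← Real.sqrt_sq (hBpos τ hτ)]
    congr 1
    rw [hB, Real.tan_eq_sin_div_cos]
    field_simp
    linear_combination g (ρ (χ + τ)) ^ 2 * Real.sin_sq_add_cos_sq (χ + τ)
  have hAle : A χ ≤ A χ' := by
    have := sub_le_sub_of_hasDerivAt_le (F := fun _ => (0 : ℝ)) (F' := fun _ => 0) (K := A) hle
      (fun t _ => hasDerivAt_const t _)
      (fun t ht => hA t (E.mem_Ioo ⟨h0.trans ht.1, ht.2.trans h1⟩)) (fun t ht => by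
        have := hBpos (t - χ) ⟨by linarith [ht.1], by linarith [ht.2]⟩
        simpa [hB] using this)
    linarith
  have hT : 0 ≤ χ' - χ := sub_nonneg.2 hle
  have := dist_le_of_curve hsym (c := fun τ => ρ (χ + τ) • slerp u v α (φ (χ + τ)))
    (T := χ' - χ) (L := A χ' - A χ) hT (sub_nonneg.2 hAle) ?_ ?_
  · simpa using this
  · obtain ⟨K, hK⟩ := (isCompact_Icc.image_of_continuousOn hBc).bddAbove
    refine ⟨Real.toNNReal K, (convex_Icc _ _).lipschitzOnWith_of_nnnorm_hasDerivWithin_le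
      (fun τ hτ => (hcd τ hτ).hasDerivWithinAt) fun τ hτ => ?_⟩
    rw [← NNReal.coe_le_coe, coe_nnnorm]
    refine le_trans ?_ (Real.le_coe_toNNReal K)
    refine (norm_le_warpNorm (G := G) (fun r hr => ?_) _ _).trans ((hwn τ hτ).le.trans
      (hK ⟨τ, hτ, rfl⟩))
    rw [← hgG r hr]
    exact h.self_le r
  · unfold warpLength
    have hInt : ∫ τ in (0 : ℝ)..(χ' - χ), B τ = A χ' - A χ := by
      rw [intervalIntegral.integral_eq_sub_of_hasDerivAt (f := fun τ => A (χ + τ))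
        (fun τ hτ => ?_) (hBc.mono (by rw [uIcc_of_le hT])).intervalIntegrable]
      · simp
      · rw [uIcc_of_le hT] at hτ
        exact (hA _ (hmem τ hτ)).comp_const_add χ τ
    rw [setLIntegral_congr_fun measurableSet_Icc (g := fun τ => ENNReal.ofReal (B τ))
      (fun τ hτ => by simp only; rw [(hcd τ hτ).deriv, hwn τ hτ]),
      ← ofReal_integral_eq_lintegral_ofReal (hBc.integrableOn_Icc)
        ((ae_restrict_iff' measurableSet_Icc).2 (ae_of_all _ hBpos)),
      integral_Icc_eq_integral_Ioc, ← intervalIntegral.integral_of_le hT, hInt]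

end IsExtremal

namespace IsExtremal

variable {g g₁ H : ℝ → ℝ} {χ₀ χ₁ : ℝ} {ρ φ A : ℝ → ℝ} {n : ℕ} {p : M} {G : ℝ → ℝ} {Φ : Euc n ≃ M}

theorem add_le_dist (hsym : IsSphericallySymmetric p G Φ) (h : IsRadialProfile g g₁ H)
    (hgG : ∀ r, 0 < r → g r = G r) (E : IsExtremal g g₁ χ₀ χ₁ ρ φ) (hφ : φ χ₀ = 0)
    (hA : ∀ χ ∈ Ioo (-(Real.pi / 2)) (Real.pi / 2),
      HasDerivAt A (g (ρ χ) / (g₁ (ρ χ) * Real.cos χ)) χ)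
    {ε : ℝ} (hε : ∀ t ∈ Icc χ₀ χ₁, 0 ≤ Real.cos (t + ε)) {u : Euc n} (z : Euc n) {χ : ℝ}
    (hχ : χ ∈ Icc χ₀ χ₁) (hz : φ χ ≤ angle u z) (hu : ‖u‖ = 1) :
    (‖z‖ - ρ χ) * Real.sin (χ + ε) + Real.cos ε * (A χ - A χ₀) ≤
      dist (Φ (ρ χ₀ • u)) (Φ z) := by
  have h1 := E.le_dist_of_le_angle hsym h hgG hφ hε u z hχ hz hu
  have h2 := E.support_eq h hA ε hχ
  linarith

theorem cos_nonneg (E : IsExtremal g g₁ χ₀ χ₁ ρ φ) {t : ℝ} (ht : t ∈ Icc χ₀ χ₁) :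
    0 ≤ Real.cos t := (Real.cos_pos_of_mem_Ioo (E.mem_Ioo ht)).le

theorem add_le_dist_left (hsym : IsSphericallySymmetric p G Φ) (h : IsRadialProfile g g₁ H)
    (hgG : ∀ r, 0 < r → g r = G r) (E : IsExtremal g g₁ χ₀ χ₁ ρ φ) (hφ : φ χ₀ = 0)
    (hA : ∀ χ ∈ Ioo (-(Real.pi / 2)) (Real.pi / 2),
      HasDerivAt A (g (ρ χ) / (g₁ (ρ χ) * Real.cos χ)) χ) {u : Euc n} (z : Euc n) {χ : ℝ}
    (hχ : χ ∈ Icc χ₀ χ₁) (hz : φ χ ≤ angle u z) (hu : ‖u‖ = 1) :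
    (‖z‖ - ρ χ) * Real.sin χ + (A χ - A χ₀) ≤ dist (Φ (ρ χ₀ • u)) (Φ z) := by
  simpa using E.add_le_dist hsym h hgG hφ hA (ε := 0)
    (fun t ht => by rw [add_zero]; exact E.cos_nonneg ht) z hχ hz hu

theorem add_le_dist_right (hsym : IsSphericallySymmetric p G Φ) (h : IsRadialProfile g g₁ H)
    (hgG : ∀ r, 0 < r → g r = G r) (E : IsExtremal g g₁ χ₀ χ₁ ρ φ)
    (hA : ∀ χ ∈ Ioo (-(Real.pi / 2)) (Real.pi / 2),
      HasDerivAt A (g (ρ χ) / (g₁ (ρ χ) * Real.cos χ)) χ) {v : Euc n} (z : Euc n) {χ : ℝ}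
    (hχ : χ ∈ Icc χ₀ χ₁) (hz : φ χ₁ - φ χ ≤ angle v z) (hv : ‖v‖ = 1) :
    -(‖z‖ - ρ χ) * Real.sin χ + (A χ₁ - A χ) ≤ dist (Φ (ρ χ₁ • v)) (Φ z) := by
  have := (E.reverse (φ χ₁)).add_le_dist_left hsym h hgG (by simp) (reverse_arclength hA) z
    (χ := -χ) ⟨neg_le_neg hχ.2, neg_le_neg hχ.1⟩ (by simpa using hz) hv
  simp only [neg_neg, Real.sin_neg] at this
  linarith

theorem arclength_le_dist (hsym : IsSphericallySymmetric p G Φ) (h : IsRadialProfile g g₁ H)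
    (hgG : ∀ r, 0 < r → g r = G r) (E : IsExtremal g g₁ χ₀ χ₁ ρ φ) (hφ : φ χ₀ = 0)
    (hA : ∀ χ ∈ Ioo (-(Real.pi / 2)) (Real.pi / 2),
      HasDerivAt A (g (ρ χ) / (g₁ (ρ χ) * Real.cos χ)) χ) {u v : Euc n} (hu : ‖u‖ = 1)
    (hv : ‖v‖ = 1) (huv : angle u v = φ χ₁) :
    A χ₁ - A χ₀ ≤ dist (Φ (ρ χ₀ • u)) (Φ (ρ χ₁ • v)) := by
  have hr := right_mem_Icc.2 E.lt.le
  have hρ := E.pos _ (E.mem_Ioo hr)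
  have := E.add_le_dist_left hsym h hgG hφ hA (u := u) (ρ χ₁ • v) hr
    (by rw [angle_smul_right_of_pos _ _ hρ, huv]) hu
  rwa [norm_smul, hv, mul_one, Real.norm_of_nonneg hρ.le, sub_self, zero_mul, zero_add] at this

theorem dist_curve_eq (hsym : IsSphericallySymmetric p G Φ) (h : IsRadialProfile g g₁ H)
    (hgG : ∀ r, 0 < r → g r = G r) (E : IsExtremal g g₁ χ₀ χ₁ ρ φ) (hφ : φ χ₀ = 0)
    (hA : ∀ χ ∈ Ioo (-(Real.pi / 2)) (Real.pi / 2),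
      HasDerivAt A (g (ρ χ) / (g₁ (ρ χ) * Real.cos χ)) χ) {u v : Euc n} (hu : ‖u‖ = 1)
    (hv : ‖v‖ = 1) (huv : angle u v = φ χ₁) (hα : Real.sin (φ χ₁) ≠ 0) {χ χ' : ℝ} (h0 : χ₀ ≤ χ)
    (hle : χ ≤ χ') (h1 : χ' ≤ χ₁) :
    dist (Φ (ρ χ • slerp u v (φ χ₁) (φ χ))) (Φ (ρ χ' • slerp u v (φ χ₁) (φ χ'))) =
      A χ' - A χ := by
  have huv' : ⟪u, v⟫ = Real.cos (φ χ₁) := by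
    rw [← huv, inner_eq_cos_angle_of_norm_eq_one hu hv]
  refine le_antisymm (E.dist_curve_le hsym h hgG hA hu hv huv' hα h0 hle h1) ?_
  have e0 := E.arclength_le_dist hsym h hgG hφ hA hu hv huv
  have e1 := E.dist_curve_le hsym h hgG hA hu hv huv' hα le_rfl h0 (hle.trans h1)
  have e2 := E.dist_curve_le hsym h hgG hA hu hv huv' hα (h0.trans hle) h1 le_rfl
  rw [hφ, slerp_zero hα] at e1
  rw [slerp_right hα] at e2
  have e3 := dist_triangle4 (Φ (ρ χ₀ • u)) (Φ (ρ χ • slerp u v (φ χ₁) (φ χ)))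
    (Φ (ρ χ' • slerp u v (φ χ₁) (φ χ'))) (Φ (ρ χ₁ • v))
  linarith

theorem eventually_cos_nonneg (E : IsExtremal g g₁ χ₀ χ₁ ρ φ) :
    ∀ᶠ ε : ℝ in nhds 0, ∀ t ∈ Icc χ₀ χ₁, 0 ≤ Real.cos (t + ε) := by
  have h1 : (0 : ℝ) < Real.pi / 2 - χ₁ := by linarith [E.right_mem]
  have h2 : -(Real.pi / 2) - χ₀ < (0 : ℝ) := by linarith [E.left_mem]
  filter_upwards [eventually_lt_nhds h1, eventually_gt_nhds h2] with ε h3 h4 t ht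
  exact Real.cos_nonneg_of_mem_Icc ⟨by linarith [ht.1], by linarith [ht.2]⟩

theorem norm_eq_of_tight (hsym : IsSphericallySymmetric p G Φ) (h : IsRadialProfile g g₁ H)
    (hgG : ∀ r, 0 < r → g r = G r) (E : IsExtremal g g₁ χ₀ χ₁ ρ φ) (hφ : φ χ₀ = 0)
    (hA : ∀ χ ∈ Ioo (-(Real.pi / 2)) (Real.pi / 2),
      HasDerivAt A (g (ρ χ) / (g₁ (ρ χ) * Real.cos χ)) χ) {u : Euc n} {z : Euc n} {χ : ℝ}
    (hχ : χ ∈ Icc χ₀ χ₁) (hz : φ χ ≤ angle u z) (hu : ‖u‖ = 1)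
    (heq : dist (Φ (ρ χ₀ • u)) (Φ z) ≤ (‖z‖ - ρ χ) * Real.sin χ + (A χ - A χ₀)) :
    ‖z‖ = ρ χ ∧ (χ < χ₁ → angle u z = φ χ) := by
  have hcos := Real.cos_pos_of_mem_Ioo (E.mem_Ioo hχ)
  have hnorm : ‖z‖ = ρ χ := by
    have hmax : IsLocalMax
        (fun ε => (‖z‖ - ρ χ) * Real.sin (χ + ε) + Real.cos ε * (A χ - A χ₀)) 0 := by
      filter_upwards [E.eventually_cos_nonneg] with ε hε
      simpa using (E.add_le_dist hsym h hgG hφ hA hε z hχ hz hu).trans heq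
    have hd : HasDerivAt
        (fun ε => (‖z‖ - ρ χ) * Real.sin (χ + ε) + Real.cos ε * (A χ - A χ₀))
        ((‖z‖ - ρ χ) * Real.cos χ) 0 := by
      refine (((((hasDerivAt_id (0 : ℝ)).const_add χ).sin).const_mul (‖z‖ - ρ χ)).add
        ((Real.hasDerivAt_cos 0).mul_const (A χ - A χ₀))).congr_deriv ?_
      simp
    have := hmax.hasDerivAt_eq_zero hd
    rcases mul_eq_zero.1 this with h1 | h1
    · linarith
    · exact absurd h1 hcos.ne'
  refine ⟨hnorm, fun hlt => ?_⟩
  by_contra hne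
  have hlt' := lt_of_le_of_ne hz (Ne.symm hne)
  have hmem := E.mem_Ioo hχ
  have hg := h.pos_deriv (ρ χ)
  have hgρ := h.pos (E.pos _ hmem)
  have hd : HasDerivAt (fun t => (‖z‖ - ρ t) * Real.sin t + A t)
      (g (ρ χ) * Real.cos χ / g₁ (ρ χ)) χ := by
    refine ((((E.hasDerivAt_radius χ hmem).const_sub ‖z‖).mul (Real.hasDerivAt_sin χ)).add
      (hA χ hmem)).congr_deriv ?_
    rw [hnorm, Real.tan_eq_sin_div_cos]
    field_simp
    linear_combination (-g (ρ χ)) * Real.sin_sq_add_cos_sq χ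
  have hpos : 0 < g (ρ χ) * Real.cos χ / g₁ (ρ χ) := div_pos (mul_pos hgρ hcos) hg
  have e1 : ∀ᶠ t in nhdsWithin χ (Ioi χ),
      0 < slope (fun t => (‖z‖ - ρ t) * Real.sin t + A t) χ t :=
    ((hasDerivAt_iff_tendsto_slope.1 hd).mono_left
      (nhdsWithin_mono _ fun t ht => (ne_of_gt ht))).eventually (eventually_gt_nhds hpos)
  have e2 : ∀ᶠ t in nhdsWithin χ (Ioi χ), φ t < angle u z :=
    ((E.hasDerivAt_angle χ hmem).continuousAt.continuousWithinAt).eventually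
      (eventually_lt_nhds hlt')
  have e3 : ∀ᶠ t in nhdsWithin χ (Ioi χ), t ∈ Ioo χ χ₁ := Ioo_mem_nhdsGT hlt
  obtain ⟨t, h1, h2, h3⟩ := (e1.and (e2.and e3)).exists
  have h4 := E.add_le_dist_left hsym h hgG hφ hA z ⟨hχ.1.trans h3.1.le, h3.2.le⟩ h2.le hu
  rw [slope_def_field, div_pos_iff_of_pos_right (sub_pos.2 h3.1)] at h1
  linarith

theorem exists_of_tight (hsym : IsSphericallySymmetric p G Φ) (h : IsRadialProfile g g₁ H)
    (hgG : ∀ r, 0 < r → g r = G r) (E : IsExtremal g g₁ χ₀ χ₁ ρ φ) (hφ : φ χ₀ = 0)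
    (hA : ∀ χ ∈ Ioo (-(Real.pi / 2)) (Real.pi / 2),
      HasDerivAt A (g (ρ χ) / (g₁ (ρ χ) * Real.cos χ)) χ) {u v : Euc n} (hu : ‖u‖ = 1)
    (hv : ‖v‖ = 1) (huv : angle u v = φ χ₁) (hα : Real.sin (φ χ₁) ≠ 0) {z : Euc n}
    (hz : dist (Φ (ρ χ₀ • u)) (Φ z) + dist (Φ z) (Φ (ρ χ₁ • v)) ≤ A χ₁ - A χ₀) :
    ∃ χ ∈ Icc χ₀ χ₁, angle u z = φ χ ∧ angle v z = φ χ₁ - φ χ ∧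
      z = ρ χ • slerp u v (φ χ₁) (φ χ) := by
  have hα0 : 0 ≤ φ χ₁ := by rw [← huv]; exact angle_nonneg _ _
  have t1 := angle_le_angle_add_angle u z v
  have t2 := angle_le_angle_add_angle u v z
  have t3 := angle_le_angle_add_angle v u z
  rw [angle_comm z v, huv] at t1
  rw [huv] at t2
  rw [angle_comm v u, huv] at t3
  have hv0 := angle_nonneg v z
  have hu0 := angle_nonneg u z
  obtain ⟨χ, hχ, hφχ⟩ : max (φ χ₁ - angle v z) 0 ∈ φ '' Icc χ₀ χ₁ := by
    refine intermediate_value_Icc E.lt.le E.continuousOn_angle ?_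
    rw [hφ]
    exact ⟨le_max_right _ _, max_le (by linarith) hα0⟩
  have c1 : φ χ ≤ angle u z := by rw [hφχ]; exact max_le (by linarith) hu0
  have c2 : φ χ₁ - φ χ ≤ angle v z := by
    have := le_max_left (φ χ₁ - angle v z) 0
    linarith
  have d2 := E.add_le_dist_right hsym h hgG hA z hχ c2 hv
  rw [dist_comm] at d2
  obtain ⟨hnorm, hang⟩ := E.norm_eq_of_tight hsym h hgG hφ hA hχ c1 hu (by linarith)
  have a1 : angle u z = φ χ := by
    rcases hχ.2.lt_or_eq with hlt | heq
    · exact hang hlt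
    · rw [heq] at hφχ c1 ⊢
      rcases max_choice (φ χ₁ - angle v z) 0 with hm | hm
      · rw [hm] at hφχ
        linarith
      · rw [hm] at hφχ
        rw [hφχ] at hα
        simp at hα
  have a2 : angle v z = φ χ₁ - φ χ := by
    rcases max_choice (φ χ₁ - angle v z) 0 with hm | hm
    · rw [hm] at hφχ
      linarith
    · rw [hm] at hφχ
      linarith
  have hρ := E.pos _ (E.mem_Ioo hχ)
  have hz0 : ‖z‖ ≠ 0 := by rw [hnorm]; exact hρ.ne'
  refine ⟨χ, hχ, a1, a2, ?_⟩
  have hw : ‖‖z‖⁻¹ • z‖ = 1 := by rw [norm_smul, norm_inv, norm_norm, inv_mul_cancel₀ hz0]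
  have hi : 0 < ‖z‖⁻¹ := by rw [hnorm]; exact inv_pos.2 hρ
  rw [← eq_slerp hu hv (by rw [← huv, inner_eq_cos_angle_of_norm_eq_one hu hv]) hα hw
    (by rw [inner_eq_cos_angle_of_norm_eq_one hu hw, angle_smul_right_of_pos _ _ hi, a1])
    (by rw [inner_eq_cos_angle_of_norm_eq_one hv hw, angle_smul_right_of_pos _ _ hi, a2]),
    ← hnorm, smul_inv_smul₀ hz0]

/-- The polar angle parametrizes an extremal continuously. -/
theorem exists_inverse (E : IsExtremal g g₁ χ₀ χ₁ ρ φ) (h : IsRadialProfile g g₁ H) :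
    ∃ ψ : ℝ → ℝ, ContinuousOn ψ (Icc (φ χ₀) (φ χ₁)) ∧ MapsTo ψ (Icc (φ χ₀) (φ χ₁)) (Icc χ₀ χ₁) ∧
      (∀ β ∈ Icc (φ χ₀) (φ χ₁), φ (ψ β) = β) ∧ ∀ χ ∈ Icc χ₀ χ₁, ψ (φ χ) = χ := by
  have hmono : StrictMonoOn φ (Icc χ₀ χ₁) :=
    (E.strictMonoOn_angle h).mono fun t ht => E.mem_Ioo ht
  have hex : ∀ β : ℝ, ∃ χ, β ∈ Icc (φ χ₀) (φ χ₁) → χ ∈ Icc χ₀ χ₁ ∧ φ χ = β := fun β => by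
    by_cases hβ : β ∈ Icc (φ χ₀) (φ χ₁)
    · obtain ⟨χ, h1, h2⟩ := intermediate_value_Icc E.lt.le E.continuousOn_angle hβ
      exact ⟨χ, fun _ => ⟨h1, h2⟩⟩
    · exact ⟨0, fun h => absurd h hβ⟩
  choose ψ hψ using hex
  obtain ⟨m, hm0, hm⟩ := E.exists_sub_le_mul_sub h
  refine ⟨ψ, ?_, fun β hβ => (hψ β hβ).1, fun β hβ => (hψ β hβ).2, fun χ hχ => ?_⟩
  · refine (LipschitzOnWith.of_le_add_mul (Real.toNNReal m) fun β hβ β' hβ' => ?_).continuousOn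
    rw [Real.coe_toNNReal _ hm0, Real.dist_eq]
    obtain ⟨h1, h2⟩ := hψ β hβ
    obtain ⟨h3, h4⟩ := hψ β' hβ'
    rcases le_total (ψ β) (ψ β') with hle | hle
    · have := mul_nonneg hm0 (abs_nonneg (β - β'))
      linarith
    · have e1 := hm _ _ h3.1 hle h1.2
      rw [h2, h4] at e1
      have e2 := mul_le_mul_of_nonneg_left (le_abs_self (β - β')) hm0
      linarith
  · have hφχ : φ χ ∈ Icc (φ χ₀) (φ χ₁) :=
      ⟨hmono.monotoneOn (left_mem_Icc.2 E.lt.le) hχ hχ.1,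
        hmono.monotoneOn hχ (right_mem_Icc.2 E.lt.le) hχ.2⟩
    exact hmono.injOn (hψ _ hφχ).1 hχ (hψ _ hφχ).2

end IsExtremal

/-- The point with radius `σ β` on the ray at angle `β` from `a` towards `b`. -/
def arcPoint {n : ℕ} (a b : Euc n) (σ : ℝ → ℝ) (β : ℝ) : Euc n :=
  σ β • slerp (‖a‖⁻¹ • a) (‖b‖⁻¹ • b) (angle a b) β

/-- `arcPoint a b σ` is the unique minimizing geodesic between non-collinear `a` and `b`,
parametrized by the polar angle, with arclength `L`. -/
structure IsArc {n : ℕ} (Φ : Euc n ≃ M) (a b : Euc n) (σ L : ℝ → ℝ) : Prop where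
  continuousOn_radius : ContinuousOn σ (Icc 0 (angle a b))
  continuousOn_length : ContinuousOn L (Icc 0 (angle a b))
  pos : ∀ β ∈ Icc 0 (angle a b), 0 < σ β
  left : σ 0 = ‖a‖
  right : σ (angle a b) = ‖b‖
  dist_eq : ∀ β β', 0 ≤ β → β ≤ β' → β' ≤ angle a b →
    dist (Φ (arcPoint a b σ β)) (Φ (arcPoint a b σ β')) = L β' - L β
  eq_of_tight : ∀ z, dist (Φ a) (Φ z) + dist (Φ z) (Φ b) = dist (Φ a) (Φ b) →
    angle a z + angle b z = angle a b ∧ z = arcPoint a b σ (angle a z)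

theorem norm_inv_norm_smul {n : ℕ} {a : Euc n} (ha : a ≠ 0) : ‖‖a‖⁻¹ • a‖ = 1 := by
  rw [norm_smul, norm_inv, norm_norm, inv_mul_cancel₀ (norm_ne_zero_iff.2 ha)]

theorem angle_inv_norm_smul_left {n : ℕ} {a : Euc n} (ha : a ≠ 0) (b : Euc n) :
    angle (‖a‖⁻¹ • a) b = angle a b :=
  angle_smul_left_of_pos _ _ (inv_pos.2 (norm_pos_iff.2 ha))

theorem angle_inv_norm_smul_right {n : ℕ} (a : Euc n) {b : Euc n} (hb : b ≠ 0) :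
    angle a (‖b‖⁻¹ • b) = angle a b :=
  angle_smul_right_of_pos _ _ (inv_pos.2 (norm_pos_iff.2 hb))

theorem exists_isArc_of_norm_le {n : ℕ} {p : M} {G g g₁ H : ℝ → ℝ} {Φ : Euc n ≃ M}
    (hsym : IsSphericallySymmetric p G Φ) (h : IsRadialProfile g g₁ H)
    (hgG : ∀ r, 0 < r → g r = G r) {a b : Euc n} (ha : a ≠ 0) (hb : b ≠ 0)
    (h0 : 0 < angle a b) (hπ : angle a b < Real.pi) (hab : ‖a‖ ≤ ‖b‖) :
    ∃ σ L, IsArc Φ a b σ L := by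
  obtain ⟨χ₀, χ₁, ρ, φ, E, hρ0, hρ1, hφ0, hφ1⟩ :=
    exists_extremal h (norm_pos_iff.2 ha) hab h0 hπ
  obtain ⟨A, hA⟩ := E.exists_arclength h
  obtain ⟨ψ, hψc, hψm, hφψ, hψφ⟩ := E.exists_inverse h
  have hu := norm_inv_norm_smul ha
  have hv := norm_inv_norm_smul hb
  have huv : angle (‖a‖⁻¹ • a) (‖b‖⁻¹ • b) = φ χ₁ := by
    rw [angle_inv_norm_smul_left ha, angle_inv_norm_smul_right _ hb, hφ1]
  have hα : Real.sin (φ χ₁) ≠ 0 := by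
    rw [hφ1]; exact (Real.sin_pos_of_pos_of_lt_pi h0 hπ).ne'
  have hA' : ρ χ₀ • (‖a‖⁻¹ • a) = a := by
    rw [hρ0, smul_inv_smul₀ (norm_ne_zero_iff.2 ha)]
  have hB' : ρ χ₁ • (‖b‖⁻¹ • b) = b := by
    rw [hρ1, smul_inv_smul₀ (norm_ne_zero_iff.2 hb)]
  have hl := left_mem_Icc.2 E.lt.le
  have hr := right_mem_Icc.2 E.lt.le
  have hdist := E.dist_curve_eq hsym h hgG hφ0 hA hu hv huv hα le_rfl E.lt.le le_rfl
  rw [hφ0, slerp_zero hα, slerp_right hα, hA', hB'] at hdist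
  have hIcc : Icc (φ χ₀) (φ χ₁) = Icc 0 (angle a b) := by rw [hφ0, hφ1]
  rw [hIcc] at hψc hψm hφψ
  have hmono : ∀ β β', 0 ≤ β → β ≤ β' → β' ≤ angle a b → ψ β ≤ ψ β' := fun β β' h1 h2 h3 => by
    by_contra hlt
    push Not at hlt
    have m1 : β ∈ Icc 0 (angle a b) := ⟨h1, h2.trans h3⟩
    have m2 : β' ∈ Icc 0 (angle a b) := ⟨h1.trans h2, h3⟩
    have := E.strictMonoOn_angle h (E.mem_Ioo (hψm m2)) (E.mem_Ioo (hψm m1)) hlt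
    rw [hφψ _ m1, hφψ _ m2] at this
    linarith
  refine ⟨fun β => ρ (ψ β), fun β => A (ψ β),
    E.continuousOn_radius.comp hψc fun β hβ => E.mem_Ioo (hψm hβ),
    ContinuousOn.comp (t := Icc χ₀ χ₁)
      (fun t ht => (hA t (E.mem_Ioo ht)).continuousAt.continuousWithinAt) hψc hψm,
    fun β hβ => E.pos _ (E.mem_Ioo (hψm hβ)), ?_, ?_, fun β β' h1 h2 h3 => ?_, fun z hz => ?_⟩
  · rw [← hφ0, hψφ _ hl, hρ0]
  · rw [← hφ1, hψφ _ hr, hρ1]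
  · have m1 : β ∈ Icc 0 (angle a b) := ⟨h1, h2.trans h3⟩
    have m2 : β' ∈ Icc 0 (angle a b) := ⟨h1.trans h2, h3⟩
    have := E.dist_curve_eq hsym h hgG hφ0 hA hu hv huv hα (hψm m1).1 (hmono β β' h1 h2 h3)
      (hψm m2).2
    rwa [hφψ _ m1, hφψ _ m2, hφ1] at this
  · obtain ⟨χ, hχ, e1, e2, e3⟩ := E.exists_of_tight hsym h hgG hφ0 hA hu hv huv hα (z := z)
      (by rw [hA', hB', hz, hdist])
    rw [angle_inv_norm_smul_left ha] at e1
    rw [angle_inv_norm_smul_left hb, hφ1] at e2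
    refine ⟨by rw [e1, e2]; ring, ?_⟩
    rw [e1, arcPoint, hψφ χ hχ, ← hφ1]
    exact e3

theorem arcPoint_swap {n : ℕ} (a b : Euc n) (σ : ℝ → ℝ) (β : ℝ) :
    arcPoint b a (fun β => σ (angle a b - β)) β = arcPoint a b σ (angle a b - β) := by
  rw [arcPoint, arcPoint, ← slerp_swap (‖a‖⁻¹ • a), angle_comm b a, _root_.sub_sub_cancel]

theorem IsArc.swap {n : ℕ} {Φ : Euc n ≃ M} {a b : Euc n} {σ L : ℝ → ℝ} (I : IsArc Φ a b σ L) :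
    IsArc Φ b a (fun β => σ (angle a b - β)) (fun β => -L (angle a b - β)) := by
  have hm : MapsTo (fun β => angle a b - β) (Icc 0 (angle a b)) (Icc 0 (angle a b)) :=
    fun β hβ => ⟨by linarith [hβ.2], by linarith [hβ.1]⟩
  refine ⟨?_, ?_, ?_, ?_, ?_, ?_, ?_⟩
  · rw [angle_comm b a]
    exact I.continuousOn_radius.comp (by fun_prop) hm
  · rw [angle_comm b a]
    exact (I.continuousOn_length.comp (by fun_prop) hm).neg
  · rw [angle_comm b a]
    exact fun β hβ => I.pos _ (hm hβ)
  · rw [sub_zero, I.right]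
  · rw [angle_comm b a, sub_self, I.left]
  · intro β β' h1 h2 h3
    rw [angle_comm b a] at h3
    rw [arcPoint_swap, arcPoint_swap, dist_comm, I.dist_eq _ _ (by linarith) (by linarith)
      (by linarith)]
    ring
  · intro z hz
    obtain ⟨e1, e2⟩ := I.eq_of_tight z (by
      rw [dist_comm (Φ a), dist_comm _ (Φ b), dist_comm (Φ a) (Φ b), ← hz]; ring)
    refine ⟨by rw [angle_comm b a, ← e1, add_comm], ?_⟩
    rw [arcPoint_swap, show angle a b - angle b z = angle a z by linarith]
    exact e2

theorem exists_isArc {n : ℕ} {p : M} {G g g₁ H : ℝ → ℝ} {Φ : Euc n ≃ M}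
    (hsym : IsSphericallySymmetric p G Φ) (h : IsRadialProfile g g₁ H)
    (hgG : ∀ r, 0 < r → g r = G r) {a b : Euc n} (ha : a ≠ 0) (hb : b ≠ 0)
    (h0 : 0 < angle a b) (hπ : angle a b < Real.pi) : ∃ σ L, IsArc Φ a b σ L := by
  rcases le_total ‖a‖ ‖b‖ with hab | hab
  · exact exists_isArc_of_norm_le hsym h hgG ha hb h0 hπ hab
  · rw [angle_comm] at h0 hπ
    obtain ⟨σ, L, I⟩ := exists_isArc_of_norm_le hsym h hgG hb ha h0 hπ hab
    exact ⟨_, _, I.swap⟩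

namespace IsArc

variable {n : ℕ} {Φ : Euc n ≃ M} {a b : Euc n} {σ L : ℝ → ℝ}

theorem arcPoint_zero (I : IsArc Φ a b σ L) (ha : a ≠ 0) (hα : Real.sin (angle a b) ≠ 0) :
    arcPoint a b σ 0 = a := by
  rw [arcPoint, slerp_zero hα, I.left, smul_inv_smul₀ (norm_ne_zero_iff.2 ha)]

theorem arcPoint_angle (I : IsArc Φ a b σ L) (hb : b ≠ 0) (hα : Real.sin (angle a b) ≠ 0) :
    arcPoint a b σ (angle a b) = b := by
  rw [arcPoint, slerp_right hα, I.right, smul_inv_smul₀ (norm_ne_zero_iff.2 hb)]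

theorem dist_endpoints (I : IsArc Φ a b σ L) (ha : a ≠ 0) (hb : b ≠ 0)
    (hα : Real.sin (angle a b) ≠ 0) : dist (Φ a) (Φ b) = L (angle a b) - L 0 := by
  have := I.dist_eq 0 (angle a b) le_rfl (angle_nonneg _ _) le_rfl
  rwa [I.arcPoint_zero ha hα, I.arcPoint_angle hb hα] at this

theorem dist_left (I : IsArc Φ a b σ L) (ha : a ≠ 0) (hα : Real.sin (angle a b) ≠ 0) {β : ℝ}
    (hβ : β ∈ Icc 0 (angle a b)) : dist (Φ a) (Φ (arcPoint a b σ β)) = L β - L 0 := by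
  have := I.dist_eq 0 β le_rfl hβ.1 hβ.2
  rwa [I.arcPoint_zero ha hα] at this

theorem dist_right (I : IsArc Φ a b σ L) (hb : b ≠ 0) (hα : Real.sin (angle a b) ≠ 0) {β : ℝ}
    (hβ : β ∈ Icc 0 (angle a b)) :
    dist (Φ (arcPoint a b σ β)) (Φ b) = L (angle a b) - L β := by
  have := I.dist_eq β (angle a b) hβ.1 hβ.2 le_rfl
  rwa [I.arcPoint_angle hb hα] at this

theorem inner_left_arc (ha : a ≠ 0) (hb : b ≠ 0) :
    ⟪‖a‖⁻¹ • a, ‖b‖⁻¹ • b⟫ = Real.cos (angle a b) := by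
  rw [inner_eq_cos_angle_of_norm_eq_one (norm_inv_norm_smul ha) (norm_inv_norm_smul hb),
    angle_inv_norm_smul_left ha, angle_inv_norm_smul_right _ hb]

theorem norm_arcPoint (I : IsArc Φ a b σ L) (ha : a ≠ 0) (hb : b ≠ 0)
    (hα : Real.sin (angle a b) ≠ 0) {β : ℝ} (hβ : β ∈ Icc 0 (angle a b)) :
    ‖arcPoint a b σ β‖ = σ β := by
  rw [arcPoint, norm_smul, norm_slerp (norm_inv_norm_smul ha) (norm_inv_norm_smul hb)
    (inner_left_arc ha hb) hα, mul_one, Real.norm_of_nonneg (I.pos β hβ).le]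

theorem angle_left_arcPoint (I : IsArc Φ a b σ L) (ha : a ≠ 0) (hb : b ≠ 0)
    (hα : Real.sin (angle a b) ≠ 0) {β : ℝ} (hβ : β ∈ Icc 0 (angle a b)) :
    angle a (arcPoint a b σ β) = β := by
  have hu := norm_inv_norm_smul ha
  have hv := norm_inv_norm_smul hb
  rw [← angle_inv_norm_smul_left ha, arcPoint, angle_smul_right_of_pos _ _ (I.pos β hβ), angle, hu,
    norm_slerp hu hv (inner_left_arc ha hb) hα, inner_left_slerp hu (inner_left_arc ha hb) hα,
    mul_one, div_one, Real.arccos_cos hβ.1 (hβ.2.trans (angle_le_pi _ _))]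

theorem arcPoint_ne_zero (I : IsArc Φ a b σ L) (ha : a ≠ 0) (hb : b ≠ 0)
    (hα : Real.sin (angle a b) ≠ 0) {β : ℝ} (hβ : β ∈ Icc 0 (angle a b)) :
    arcPoint a b σ β ≠ 0 := by
  rw [← norm_pos_iff, I.norm_arcPoint ha hb hα hβ]
  exact I.pos β hβ

end IsArc

theorem IsArc.exists_isMinGeodesicFromTo {n : ℕ} {Φ : Euc n ≃ M} {a b : Euc n} {σ L : ℝ → ℝ}
    (I : IsArc Φ a b σ L) (ha : a ≠ 0) (hb : b ≠ 0) (hα : Real.sin (angle a b) ≠ 0) :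
    ∃ γ, IsMinGeodesicFromTo γ (Φ a) (Φ b) ∧
      ∀ z, dist (Φ a) (Φ z) + dist (Φ z) (Φ b) = dist (Φ a) (Φ b) →
        Φ z = γ (dist (Φ a) (Φ z)) := by
  have hD := I.dist_endpoints ha hb hα
  have hex : ∀ s : ℝ, ∃ β, s ∈ Icc 0 (dist (Φ a) (Φ b)) →
      β ∈ Icc 0 (angle a b) ∧ L β = L 0 + s := fun s => by
    by_cases hs : s ∈ Icc 0 (dist (Φ a) (Φ b))
    · obtain ⟨β, h1, h2⟩ := intermediate_value_Icc (angle_nonneg a b) I.continuousOn_length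
        (show L 0 + s ∈ Icc (L 0) (L (angle a b)) from ⟨by linarith [hs.1], by linarith [hs.2]⟩)
      exact ⟨β, fun _ => ⟨h1, h2⟩⟩
    · exact ⟨0, fun h => absurd h hs⟩
  choose β hβ using hex
  have hdist : ∀ β₁ ∈ Icc 0 (angle a b), ∀ β₂ ∈ Icc 0 (angle a b),
      dist (Φ (arcPoint a b σ β₁)) (Φ (arcPoint a b σ β₂)) = |L β₁ - L β₂| := by
    intro β₁ h1 β₂ h2
    rcases le_total β₁ β₂ with hle | hle
    · have h3 := I.dist_eq β₁ β₂ h1.1 hle h2.2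
      rw [abs_sub_comm, ← h3, abs_of_nonneg dist_nonneg]
    · have h3 := I.dist_eq β₂ β₁ h2.1 hle h1.2
      rw [← h3, abs_of_nonneg dist_nonneg, dist_comm]
  have h0 : (0 : ℝ) ∈ Icc 0 (angle a b) := ⟨le_rfl, angle_nonneg _ _⟩
  have h1 : angle a b ∈ Icc 0 (angle a b) := ⟨angle_nonneg _ _, le_rfl⟩
  have hs0 : (0 : ℝ) ∈ Icc 0 (dist (Φ a) (Φ b)) := ⟨le_rfl, dist_nonneg⟩
  have hs1 : dist (Φ a) (Φ b) ∈ Icc 0 (dist (Φ a) (Φ b)) := ⟨dist_nonneg, le_rfl⟩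
  refine ⟨fun s => Φ (arcPoint a b σ (β s)), ⟨?_, ?_, fun s hs t ht => ?_⟩, fun z hz => ?_⟩
  · nth_rewrite 2 [← I.arcPoint_zero ha hα]
    rw [← dist_eq_zero, hdist _ (hβ _ hs0).1 _ h0, (hβ _ hs0).2]
    simp
  · nth_rewrite 3 [← I.arcPoint_angle hb hα]
    rw [← dist_eq_zero, hdist _ (hβ _ hs1).1 _ h1, (hβ _ hs1).2, hD]
    simp
  · rw [hdist _ (hβ s hs).1 _ (hβ t ht).1, (hβ s hs).2, (hβ t ht).2]
    congr 1
    ring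
  · obtain ⟨e1, e2⟩ := I.eq_of_tight z hz
    have hm : angle a z ∈ Icc 0 (angle a b) :=
      ⟨angle_nonneg _ _, by linarith [angle_nonneg b z]⟩
    have hs : dist (Φ a) (Φ z) ∈ Icc 0 (dist (Φ a) (Φ b)) :=
      ⟨dist_nonneg, by linarith [dist_nonneg (x := Φ z) (y := Φ b)]⟩
    have hL : dist (Φ a) (Φ z) = L (angle a z) - L 0 := by
      rw [e2, I.angle_left_arcPoint ha hb hα hm]
      exact I.dist_left ha hα hm
    nth_rewrite 1 [e2]
    rw [← dist_eq_zero, hdist _ hm _ (hβ _ hs).1, (hβ _ hs).2, hL]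
    simp

section collinear

variable {n : ℕ} {p : M} {G : ℝ → ℝ} {Φ : Euc n ≃ M}

theorem exists_of_tight_collinear (hsym : IsSphericallySymmetric p G Φ)
    (hG : ∀ r, 0 < r → r ≤ G r) {u : Euc n} (hu : ‖u‖ = 1) {s c : ℝ} {z : Euc n}
    (hz : dist (Φ (s • u)) (Φ z) + dist (Φ z) (Φ (c • u)) = dist (Φ (s • u)) (Φ (c • u))) :
    ∃ t ∈ Icc (0 : ℝ) 1, z = (s + t * (c - s)) • u := by
  have h1 := norm_sub_le_dist hsym hG (s • u) z
  have h2 := norm_sub_le_dist hsym hG z (c • u)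
  have h3 := dist_smul_smul hsym hG hu s c
  have h4 : dist (s • u) (c • u) = |s - c| := by
    rw [dist_eq_norm, ← sub_smul, norm_smul, hu, mul_one, Real.norm_eq_abs]
  have h5 : dist (s • u) z + dist z (c • u) = dist (s • u) (c • u) := by
    refine le_antisymm ?_ (dist_triangle _ _ _)
    rw [dist_comm, dist_eq_norm, dist_comm z, dist_eq_norm (c • u), h4, ← h3]
    linarith
  obtain ⟨t, ht, rfl⟩ := dist_add_dist_eq_iff.1 h5
  refine ⟨t, ht, ?_⟩
  rw [AffineMap.lineMap_apply_module']
  module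

theorem exists_isMinGeodesicFromTo_collinear (hsym : IsSphericallySymmetric p G Φ)
    (hG : ∀ r, 0 < r → r ≤ G r) {u : Euc n} (hu : ‖u‖ = 1) (s c : ℝ) :
    ∃ γ, IsMinGeodesicFromTo γ (Φ (s • u)) (Φ (c • u)) ∧
      ∀ z, dist (Φ (s • u)) (Φ z) + dist (Φ z) (Φ (c • u)) = dist (Φ (s • u)) (Φ (c • u)) →
        Φ z = γ (dist (Φ (s • u)) (Φ z)) := by
  obtain ⟨e, he, hes⟩ : ∃ e : ℝ, |e| = 1 ∧ e * |s - c| = c - s := by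
    rcases le_total s c with h | h
    · exact ⟨1, abs_one, by rw [abs_of_nonpos (sub_nonpos.2 h)]; ring⟩
    · exact ⟨-1, by simp, by rw [abs_of_nonneg (sub_nonneg.2 h)]; ring⟩
  refine ⟨fun t => Φ ((s + e * t) • u), ⟨by simp, ?_, fun t _ t' _ => ?_⟩, fun z hz => ?_⟩
  · simp only
    rw [dist_smul_smul hsym hG hu, hes, add_sub_cancel]
  · rw [dist_smul_smul hsym hG hu, show s + e * t - (s + e * t') = e * (t - t') by ring, abs_mul,
      he, one_mul]
  · obtain ⟨t, ht, rfl⟩ := exists_of_tight_collinear hsym hG hu hz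
    simp only
    rw [dist_smul_smul hsym hG hu, show s - (s + t * (c - s)) = t * (s - c) by ring, abs_mul,
      abs_of_nonneg ht.1, mul_left_comm, hes]

end collinear

theorem exists_smul_of_sin_angle_eq_zero {n : ℕ} {a b : Euc n} (ha : a ≠ 0)
    (h : b = 0 ∨ Real.sin (angle a b) = 0) : ∃ c : ℝ, b = c • ‖a‖⁻¹ • a := by
  have hn := norm_ne_zero_iff.2 ha
  suffices ∃ c : ℝ, b = c • a by
    obtain ⟨c, rfl⟩ := this
    exact ⟨c * ‖a‖, by rw [mul_smul, smul_inv_smul₀ hn]⟩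
  rcases h with rfl | h
  · exact ⟨0, by simp⟩
  · rcases sin_eq_zero_iff_angle_eq_zero_or_angle_eq_pi.1 h with h | h
    · obtain ⟨-, r, -, hr⟩ := angle_eq_zero_iff.1 h
      exact ⟨r, hr⟩
    · obtain ⟨-, r, -, hr⟩ := angle_eq_pi_iff.1 h
      exact ⟨r, hr⟩

theorem exists_isMinGeodesicFromTo {n : ℕ} {p : M} {G : ℝ → ℝ} {Φ : Euc n ≃ M}
    (hsym : IsSphericallySymmetric p G Φ) (hnpc : NonposCurvWarping G) {a : Euc n} (ha : a ≠ 0)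
    (b : Euc n) : ∃ γ, IsMinGeodesicFromTo γ (Φ a) (Φ b) ∧
      ∀ z, dist (Φ a) (Φ z) + dist (Φ z) (Φ b) = dist (Φ a) (Φ b) →
        Φ z = γ (dist (Φ a) (Φ z)) := by
  obtain ⟨g, g₁, H, h, hgG⟩ := exists_isRadialProfile hsym.1 hnpc
  by_cases hc : b = 0 ∨ Real.sin (angle a b) = 0
  · obtain ⟨c, rfl⟩ := exists_smul_of_sin_angle_eq_zero ha hc
    have := exists_isMinGeodesicFromTo_collinear hsym
      (fun r hr => by rw [← hgG r hr]; exact h.self_le r) (norm_inv_norm_smul ha) ‖a‖ c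
    rwa [smul_inv_smul₀ (norm_ne_zero_iff.2 ha)] at this
  · push Not at hc
    obtain ⟨hb, hα⟩ := hc
    have h0 : 0 < angle a b := (angle_nonneg _ _).lt_of_ne fun h => hα (by rw [← h, Real.sin_zero])
    have hπ : angle a b < Real.pi := (angle_le_pi _ _).lt_of_ne fun h => hα (by rw [h, Real.sin_pi])
    obtain ⟨σ, L, I⟩ := exists_isArc hsym h hgG ha hb h0 hπ
    exact I.exists_isMinGeodesicFromTo ha hb hα

/-- Two geodesics from the same point that meet again agree up to the meeting point. -/
theorem IsArc.arcPoint_eq_of_le {n : ℕ} {p : M} {G g g₁ H : ℝ → ℝ} {Φ : Euc n ≃ M}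
    (hsym : IsSphericallySymmetric p G Φ) (h : IsRadialProfile g g₁ H)
    (hgG : ∀ r, 0 < r → g r = G r) {a b b' : Euc n} (ha : a ≠ 0) (hb : b ≠ 0) (hb' : b' ≠ 0)
    (hα : Real.sin (angle a b) ≠ 0) (hα' : Real.sin (angle a b') ≠ 0) {σ L σ' L' : ℝ → ℝ}
    (I : IsArc Φ a b σ L) (I' : IsArc Φ a b' σ' L') {β γ : ℝ} (h0 : 0 ≤ β) (hβγ : β < γ)
    (hγ : γ ≤ angle a b) (hγ' : γ ≤ angle a b')
    (heq : arcPoint a b σ γ = arcPoint a b' σ' γ) : arcPoint a b σ β = arcPoint a b' σ' β := by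
  have m1 : β ∈ Icc 0 (angle a b) := ⟨h0, hβγ.le.trans hγ⟩
  have m2 : γ ∈ Icc 0 (angle a b) := ⟨h0.trans hβγ.le, hγ⟩
  have m1' : β ∈ Icc 0 (angle a b') := ⟨h0, hβγ.le.trans hγ'⟩
  have m2' : γ ∈ Icc 0 (angle a b') := ⟨h0.trans hβγ.le, hγ'⟩
  have hw0 := I.arcPoint_ne_zero ha hb hα m2
  have haw := I.angle_left_arcPoint ha hb hα m2
  have hπ : γ < Real.pi := by
    refine (hγ.trans (angle_le_pi _ _)).lt_of_ne fun he => hα ?_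
    rw [le_antisymm (angle_le_pi _ _) (he ▸ hγ), Real.sin_pi]
  obtain ⟨τ, K, J⟩ := exists_isArc hsym h hgG ha hw0 (by rw [haw]; exact h0.trans_lt hβγ)
    (by rw [haw]; exact hπ)
  have t1 := (J.eq_of_tight (arcPoint a b σ β) (by
    rw [I.dist_left ha hα m1, I.dist_eq β γ h0 hβγ.le hγ, I.dist_left ha hα m2]
    ring)).2
  have t2 := (J.eq_of_tight (arcPoint a b' σ' β) (by
    rw [heq, I'.dist_left ha hα' m1', I'.dist_eq β γ h0 hβγ.le hγ', I'.dist_left ha hα' m2']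
    ring)).2
  rw [I.angle_left_arcPoint ha hb hα m1] at t1
  rw [I'.angle_left_arcPoint ha hb' hα' m1'] at t2
  rw [t1, t2]

/-- Geodesics from `a` to the points of a ray are ordered by radius. -/
theorem IsArc.radius_le {n : ℕ} {p : M} {G g g₁ H : ℝ → ℝ} {Φ : Euc n ≃ M}
    (hsym : IsSphericallySymmetric p G Φ) (h : IsRadialProfile g g₁ H)
    (hgG : ∀ r, 0 < r → g r = G r) {a b b' : Euc n} (ha : a ≠ 0) (hb : b ≠ 0) (hb' : b' ≠ 0)
    (hα : Real.sin (angle a b) ≠ 0) (hbb' : ‖b‖⁻¹ • b = ‖b'‖⁻¹ • b')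
    (hang : angle a b' = angle a b) (hle : ‖b'‖ ≤ ‖b‖) {σ L σ' L' : ℝ → ℝ}
    (I : IsArc Φ a b σ L) (I' : IsArc Φ a b' σ' L') {β : ℝ} (hβ : β ∈ Icc 0 (angle a b)) :
    σ' β ≤ σ β := by
  by_contra hlt
  push Not at hlt
  have hα' : Real.sin (angle a b') ≠ 0 := by rwa [hang]
  have hsub : Icc β (angle a b) ⊆ Icc 0 (angle a b) := Icc_subset_Icc_left hβ.1
  have hc : ContinuousOn (fun t => σ t - σ' t) (Icc β (angle a b)) :=
    (I.continuousOn_radius.mono hsub).sub (I'.continuousOn_radius.mono (by rwa [hang]))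
  have hend : 0 ≤ σ (angle a b) - σ' (angle a b) := by
    have h2 := I'.right
    rw [hang] at h2
    rw [I.right, h2]
    linarith
  obtain ⟨γ, hγ, heq⟩ := intermediate_value_Icc hβ.2 hc
    (show (0 : ℝ) ∈ Icc (σ β - σ' β) (σ (angle a b) - σ' (angle a b)) from
      ⟨by linarith, hend⟩)
  replace heq : σ γ = σ' γ := sub_eq_zero.1 heq
  have hβγ : β < γ := by
    refine hγ.1.lt_of_ne fun he => ?_
    rw [← he] at heq
    linarith
  have key := IsArc.arcPoint_eq_of_le hsym h hgG ha hb hb' hα hα' I I' hβ.1 hβγ hγ.2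
    (by rw [hang]; exact hγ.2) (by rw [arcPoint, arcPoint, hbb', hang, heq])
  have t3 := I.norm_arcPoint ha hb hα hβ
  have t4 := I'.norm_arcPoint ha hb' hα' (β := β) (by rwa [hang])
  rw [key, t4] at t3
  linarith

theorem exists_tight_smul {n : ℕ} {p : M} {G : ℝ → ℝ} {Φ : Euc n ≃ M}
    (hsym : IsSphericallySymmetric p G Φ) (hnpc : NonposCurvWarping G) {a b z : Euc n}
    (ha : a ≠ 0) (hb : b ≠ 0) (h0 : 0 < angle a b) (hπ : angle a b < Real.pi) {r : ℝ} (hr : 0 < r)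
    (hr1 : r ≤ 1) (hz : dist (Φ a) (Φ z) + dist (Φ z) (Φ b) = dist (Φ a) (Φ b)) :
    angle a z ≤ angle a b ∧ ∃ κ ∈ Ioc (0 : ℝ) 1,
      dist (Φ a) (Φ (κ • z)) + dist (Φ (κ • z)) (Φ (r • b)) = dist (Φ a) (Φ (r • b)) := by
  obtain ⟨g, g₁, H, h, hgG⟩ := exists_isRadialProfile hsym.1 hnpc
  have hang : angle a (r • b) = angle a b := angle_smul_right_of_pos _ _ hr
  have hb' : r • b ≠ 0 := smul_ne_zero hr.ne' hb
  have hnorm : ‖r • b‖ = r * ‖b‖ := by rw [norm_smul, Real.norm_of_nonneg hr.le]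
  have hbb' : ‖b‖⁻¹ • b = ‖r • b‖⁻¹ • r • b := by
    rw [hnorm, smul_smul, mul_inv, mul_right_comm, inv_mul_cancel₀ hr.ne', one_mul]
  have hα : Real.sin (angle a b) ≠ 0 := (Real.sin_pos_of_pos_of_lt_pi h0 hπ).ne'
  have hα' : Real.sin (angle a (r • b)) ≠ 0 := by rwa [hang]
  obtain ⟨σ, L, I⟩ := exists_isArc hsym h hgG ha hb h0 hπ
  obtain ⟨σ', L', I'⟩ := exists_isArc hsym h hgG ha hb' (by rwa [hang]) (by rwa [hang])
  obtain ⟨e1, e2⟩ := I.eq_of_tight z hz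
  have hβ : angle a z ∈ Icc 0 (angle a b) :=
    ⟨angle_nonneg _ _, by linarith [angle_nonneg b z]⟩
  have hβ' : angle a z ∈ Icc 0 (angle a (r • b)) := by rwa [hang]
  have hle := IsArc.radius_le hsym h hgG ha hb hb' hα hbb' hang
    (by rw [hnorm]; exact mul_le_of_le_one_left (norm_nonneg _) hr1) I I' hβ
  have hσ := I.pos _ hβ
  have hσ' := I'.pos _ hβ'
  refine ⟨hβ.2, σ' (angle a z) / σ (angle a z), ⟨div_pos hσ' hσ, (div_le_one hσ).2 hle⟩, ?_⟩
  have hz' : (σ' (angle a z) / σ (angle a z)) • z = arcPoint a (r • b) σ' (angle a z) := by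
    nth_rewrite 3 [e2]
    rw [arcPoint, arcPoint, smul_smul, div_mul_cancel₀ _ hσ.ne', hbb', hang]
  rw [hz', I'.dist_left ha hα' hβ', I'.dist_right hb' hα' hβ', I'.dist_endpoints ha hb' hα']
  ring

section geodesic

theorem IsMinGeodesicFromTo.reverse {γ : ℝ → M} {x y : M} (hγ : IsMinGeodesicFromTo γ x y) :
    IsMinGeodesicFromTo (fun t => γ (dist x y - t)) y x := by
  obtain ⟨h0, h1, h2⟩ := hγ
  refine ⟨by simpa using h1, by simpa [dist_comm y x] using h0, fun s hs t ht => ?_⟩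
  rw [dist_comm y x] at hs ht
  rw [h2 _ ⟨by linarith [hs.2], by linarith [hs.1]⟩ _ ⟨by linarith [ht.2], by linarith [ht.1]⟩,
    abs_sub_comm]
  congr 1
  ring

theorem IsMinGeodesicFromTo.dist_left {γ : ℝ → M} {x y : M} (hγ : IsMinGeodesicFromTo γ x y)
    {t : ℝ} (ht : t ∈ Icc (0 : ℝ) (dist x y)) : dist x (γ t) = t := by
  have := hγ.2.2 0 ⟨le_rfl, dist_nonneg⟩ t ht
  rwa [hγ.1, zero_sub, abs_neg, abs_of_nonneg ht.1] at this

theorem IsMinGeodesicFromTo.dist_right {γ : ℝ → M} {x y : M} (hγ : IsMinGeodesicFromTo γ x y)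
    {t : ℝ} (ht : t ∈ Icc (0 : ℝ) (dist x y)) : dist (γ t) y = dist x y - t := by
  have := hγ.2.2 t ht (dist x y) ⟨dist_nonneg, le_rfl⟩
  rwa [hγ.2.1, abs_sub_comm, abs_of_nonneg (sub_nonneg.2 ht.2)] at this

theorem IsMinGeodesicFromTo.tight {γ : ℝ → M} {x y : M} (hγ : IsMinGeodesicFromTo γ x y)
    {t : ℝ} (ht : t ∈ Icc (0 : ℝ) (dist x y)) : dist x (γ t) + dist (γ t) y = dist x y := by
  rw [hγ.dist_left ht, hγ.dist_right ht]
  ring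

theorem dCompl_le_of_lipschitzOnWith {S : Set M} {γ : ℝ → M} {T : ℝ} (hT : 0 ≤ T)
    (hγ : LipschitzOnWith 1 γ (Icc 0 T)) (hS : ∀ t ∈ Icc 0 T, γ t ∉ S) :
    dCompl S (γ 0) (γ T) ≤ ENNReal.ofReal T := by
  have h0 : dCompl S (γ 0) (γ T) ≤ pathLength γ T :=
    sInf_le ⟨T, γ, hT, rfl, rfl, ⟨1, hγ⟩, hS, rfl⟩
  refine h0.trans ?_
  have h1 := hγ.comp_eVariationOn_le (g := id) (s := Icc 0 T) (mapsTo_id _)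
  have h2 : eVariationOn (id : ℝ → ℝ) (Icc 0 T) ≤ ENNReal.ofReal T := by simp
  rw [ENNReal.coe_one, one_mul] at h1
  exact h1.trans h2

theorem dCompl_le_of_isMinGeodesicFromTo {S : Set M} {γ : ℝ → M} {x y : M}
    (hγ : IsMinGeodesicFromTo γ x y) (hS : ∀ t ∈ Icc 0 (dist x y), γ t ∉ S) :
    dCompl S x y ≤ ENNReal.ofReal (dist x y) := by
  have := dCompl_le_of_lipschitzOnWith dist_nonneg (LipschitzOnWith.of_dist_le_mul
    fun s hs t ht => by rw [hγ.2.2 s hs t ht, Real.dist_eq]; simp) hS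
  rwa [hγ.1, hγ.2.1] at this

theorem dCompl_le_add {S : Set M} {γ η : ℝ → M} {x y w : M} (hγ : IsMinGeodesicFromTo γ x y)
    (hη : IsMinGeodesicFromTo η y w) (hγS : ∀ t ∈ Icc 0 (dist x y), γ t ∉ S)
    (hηS : ∀ t ∈ Icc 0 (dist y w), η t ∉ S) :
    dCompl S x w ≤ ENNReal.ofReal (dist x y + dist y w) := by
  set c : ℝ → M := fun t => if t ≤ dist x y then γ t else η (t - dist x y) with hc
  have hlip : ∀ s ∈ Icc 0 (dist x y + dist y w), ∀ t ∈ Icc 0 (dist x y + dist y w), s ≤ t →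
      dist (c s) (c t) ≤ t - s := by
    intro s hs t ht hst
    simp only [hc]
    split_ifs with h1 h2 h2
    · rw [hγ.2.2 s ⟨hs.1, h1⟩ t ⟨ht.1, h2⟩, abs_sub_comm, abs_of_nonneg (sub_nonneg.2 hst)]
    · push Not at h2
      have e1 := hγ.dist_right ⟨hs.1, h1⟩
      have e2 := hη.dist_left (t := t - dist x y) ⟨by linarith, by linarith [ht.2]⟩
      have := dist_triangle (γ s) y (η (t - dist x y))
      linarith
    · exact absurd (hst.trans h2) h1
    · push Not at h1 h2
      rw [hη.2.2 _ ⟨by linarith, by linarith [hs.2]⟩ _ ⟨by linarith, by linarith [ht.2]⟩,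
        abs_sub_comm, abs_of_nonneg (by linarith)]
      linarith
  have h0 : c 0 = x := by simp only [hc]; rw [if_pos dist_nonneg, hγ.1]
  have h1 : c (dist x y + dist y w) = w := by
    simp only [hc]
    split_ifs with h
    · have hyw : dist y w = 0 := le_antisymm (by linarith) dist_nonneg
      rw [hyw, add_zero, hγ.2.1]
      exact dist_eq_zero.1 hyw
    · rw [add_sub_cancel_left, hη.2.1]
  have := dCompl_le_of_lipschitzOnWith (S := S) (γ := c)
    (add_nonneg (dist_nonneg (x := x) (y := y)) (dist_nonneg (x := y) (y := w)))
    (LipschitzOnWith.of_dist_le_mul fun s hs t ht => ?_) fun t ht => ?_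
  · rwa [h0, h1] at this
  · rw [NNReal.coe_one, one_mul, Real.dist_eq]
    rcases le_total s t with h | h
    · exact (hlip s hs t ht h).trans (by rw [abs_sub_comm]; exact le_abs_self _)
    · rw [dist_comm]
      exact (hlip t ht s hs h).trans (le_abs_self _)
  · simp only [hc]
    split_ifs with h
    · exact hγS t ⟨ht.1, h⟩
    · push Not at h
      exact hηS _ ⟨by linarith, by linarith [ht.2]⟩

theorem le_dCompl {S : Set M} {x y : M} {r : ℝ}
    (h : ∀ (T : ℝ) (γ : ℝ → M), 0 ≤ T → γ 0 = x → γ T = y → ContinuousOn γ (Icc 0 T) →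
      (∀ t ∈ Icc 0 T, γ t ∉ S) → ∃ t ∈ Icc 0 T, r ≤ dist x (γ t) + dist (γ t) y) :
    ENNReal.ofReal r ≤ dCompl S x y := by
  refine le_sInf ?_
  rintro _ ⟨T, γ, hT, h0, h1, ⟨K, hK⟩, hS, rfl⟩
  obtain ⟨t, ht, hr⟩ := h T γ hT h0 h1 hK.continuousOn hS
  refine (ENNReal.ofReal_le_ofReal hr).trans ?_
  rw [ENNReal.ofReal_add dist_nonneg dist_nonneg, ← edist_dist, ← edist_dist, pathLength]
  have h2 := eVariationOn.Icc_add_Icc γ (s := Icc 0 T) ht.1 ht.2 ht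
  have h3 := eVariationOn.edist_le γ (s := Icc 0 T ∩ Icc 0 t) (x := 0) (y := t)
    ⟨left_mem_Icc.2 hT, left_mem_Icc.2 ht.1⟩ ⟨ht, right_mem_Icc.2 ht.1⟩
  have h4 := eVariationOn.edist_le γ (s := Icc 0 T ∩ Icc t T) (x := t) (y := T)
    ⟨ht, left_mem_Icc.2 ht.2⟩ ⟨right_mem_Icc.2 hT, right_mem_Icc.2 ht.2⟩
  rw [inter_self] at h2
  rw [← h2, ← h0, ← h1]
  exact add_le_add h3 h4

end geodesic

section Omega

variable {p q : M} {lam : ℝ}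

theorem OmegaSeq_subset_succ (p q : M) (lam : ℝ) (k : ℕ) :
    OmegaSeq p q lam k ⊆ OmegaSeq p q lam (k + 1) := fun _ hx => Or.inl hx

theorem OmegaSeq_subset_Omega (p q : M) (lam : ℝ) (k : ℕ) :
    OmegaSeq p q lam k ⊆ Omega p q lam := fun _ hx =>
  mem_iUnion.2 ⟨k, OmegaSeq_subset_succ p q lam k hx⟩

theorem mem_OmegaSeq_one (hlam : 0 ≤ lam) {x : M} (hγ : ∃ γ, IsMinGeodesicFromTo γ q x) :
    x ∈ OmegaSeq p q lam 1 ↔ lam * dist x p < dist x q := by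
  have hd : dCompl ∅ x q = ENNReal.ofReal (dist x q) := by
    obtain ⟨γ, hγ⟩ := hγ
    refine le_antisymm (dCompl_le_of_isMinGeodesicFromTo hγ.reverse fun _ _ => Set.notMem_empty _)
      (le_dCompl fun T γ hT h0 _ _ _ => ⟨0, left_mem_Icc.2 hT, ?_⟩)
    rw [h0, dist_self, zero_add]
  simp only [OmegaSeq, mem_union, mem_empty_iff_false, not_false_eq_true, true_and, false_or,
    Set.mem_ofPred_eq]
  rw [hd, ENNReal.ofReal_lt_ofReal_iff_of_nonneg (mul_nonneg hlam dist_nonneg)]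

theorem isOpen_OmegaSeq_one (hlam : 0 ≤ lam) (hgeo : ∀ x : M, ∃ γ, IsMinGeodesicFromTo γ q x) :
    IsOpen (OmegaSeq p q lam 1) := by
  have : OmegaSeq p q lam 1 = {x | lam * dist x p < dist x q} := by
    ext x; exact mem_OmegaSeq_one hlam (hgeo x)
  rw [this]
  exact isOpen_lt (by fun_prop) (by fun_prop)

theorem not_mem_OmegaSeq_one_of_mem_frontier (hlam : 0 ≤ lam)
    (hgeo : ∀ x : M, ∃ γ, IsMinGeodesicFromTo γ q x) {x : M} (hx : x ∈ frontier (Omega p q lam)) :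
    x ∉ OmegaSeq p q lam 1 := fun h =>
  hx.2 (interior_maximal (OmegaSeq_subset_Omega p q lam 1) (isOpen_OmegaSeq_one hlam hgeo) h)

/-- A visible boundary point of `Ω` satisfies the equation of the boundary of `Ω₁`. -/
theorem dist_eq_of_visibleThrough (hlam : 0 ≤ lam)
    (hgeo : ∀ x : M, ∃ γ, IsMinGeodesicFromTo γ q x) {x : M} (hx : x ∈ frontier (Omega p q lam))
    (hgeox : ∀ y : M, ∃ γ, IsMinGeodesicFromTo γ x y)
    (hvis : VisibleThrough (Omega p q lam) q x) : dist x q = lam * dist x p := by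
  have hle : dist x q ≤ lam * dist x p := by
    have := not_mem_OmegaSeq_one_of_mem_frontier hlam hgeo hx
    rwa [mem_OmegaSeq_one hlam (hgeo x), not_lt] at this
  by_contra hne
  have hlt := lt_of_le_of_ne hle hne
  set δ := (lam * dist x p - dist x q) / (1 + lam) with hδ
  have h1l : 0 < 1 + lam := by linarith
  have hδ0 : 0 < δ := div_pos (sub_pos.2 hlt) h1l
  have hδe : δ * (1 + lam) = lam * dist x p - dist x q := div_mul_cancel₀ _ h1l.ne'
  obtain ⟨η, hη⟩ := hgeo x
  have key : ∀ k, ∀ y ∈ ball x δ, y ∉ OmegaSeq p q lam k := by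
    intro k
    induction k with
    | zero => exact fun y _ => Set.notMem_empty y
    | succ k ih =>
      rintro y hy (hy' | ⟨-, hy'⟩)
      · exact ih y hy hy'
      · obtain ⟨γ, hγ⟩ := hgeox y
        rw [mem_ball] at hy
        have h1 := dCompl_le_add (S := OmegaSeq p q lam k) hγ.reverse hη.reverse
          (fun t ht => ih _ (by
            rw [dist_comm y x] at ht
            rw [mem_ball', hγ.dist_left ⟨by linarith [ht.2], by linarith [ht.1]⟩]
            rw [dist_comm] at hy
            linarith [ht.1]))
          (fun t ht hmem => hvis η hη _ (by
            rw [dist_comm x q] at ht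
            exact ⟨by linarith [ht.2], by linarith [ht.1]⟩) (OmegaSeq_subset_Omega p q lam k hmem))
        have h2 := hy'.trans_le h1
        rw [ENNReal.ofReal_lt_ofReal_iff_of_nonneg (mul_nonneg hlam dist_nonneg)] at h2
        have h3 : lam * dist x p ≤ lam * dist y x + lam * dist y p := by
          rw [← mul_add]
          refine mul_le_mul_of_nonneg_left ?_ hlam
          rw [dist_comm y x]
          exact dist_triangle _ _ _
        have h4 := mul_le_mul_of_nonneg_left hy.le hlam
        linarith
  obtain ⟨y, hy, hyx⟩ := Metric.mem_closure_iff.1 hx.1 δ hδ0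
  obtain ⟨k, hk⟩ := mem_iUnion.1 hy
  exact key _ y (by rwa [mem_ball']) hk

/-- Points of the common boundary of `Ω` and `Ω₁` are visible through `Ω₁`. -/
theorem visibleThrough_of_mem_frontier [ProperSpace M] (hlam : 0 ≤ lam)
    (hgeo : ∀ x : M, ∃ γ, IsMinGeodesicFromTo γ q x ∧
      ∀ z, dist q z + dist z x = dist q x → z = γ (dist q z))
    {x : M} (hx : x ∈ frontier (Omega p q lam)) (hxe : dist x q = lam * dist x p) :
    VisibleThrough (OmegaSeq p q lam 1) q x := by
  intro γ hγ t ht hm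
  have hgeo' : ∀ x : M, ∃ γ, IsMinGeodesicFromTo γ q x := fun x => (hgeo x).imp fun _ h => h.1
  have hopen := isOpen_OmegaSeq_one (p := p) hlam hgeo'
  have hx1 := not_mem_OmegaSeq_one_of_mem_frontier hlam hgeo' hx
  have htD : t < dist q x := ht.2.lt_of_ne fun he => hx1 (by rwa [he, hγ.2.1] at hm)
  obtain ⟨γ₀, hγ₀, huniq⟩ := hgeo x
  have hK : IsCompact {z | dist q z = t ∧ z ∉ OmegaSeq p q lam 1} := by
    refine (isCompact_sphere q t).of_isClosed_subset ?_ fun z hz => ?_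
    · exact (isClosed_eq (by fun_prop) (by fun_prop)).inter hopen.isClosed_compl
    · rw [mem_sphere, dist_comm]; exact hz.1
  have hgap : ∀ z ∈ {z | dist q z = t ∧ z ∉ OmegaSeq p q lam 1}, dist q x - t < dist z x := by
    rintro z ⟨hz1, hz2⟩
    by_contra hlt
    push Not at hlt
    have e1 : z = γ₀ (dist q z) := huniq z (le_antisymm (by linarith) (dist_triangle _ _ _))
    have e2 := huniq _ (hγ.tight ht)
    rw [hγ.dist_left ht] at e2
    rw [hz1, ← e2] at e1
    exact hz2 (e1 ▸ hm)
  obtain ⟨δ, hδ0, hδ⟩ : ∃ δ > 0, ∀ z, dist q z = t → z ∉ OmegaSeq p q lam 1 →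
      dist q x - t + δ ≤ dist z x := by
    rcases Set.eq_empty_or_nonempty {z | dist q z = t ∧ z ∉ OmegaSeq p q lam 1} with he | hne
    · refine ⟨1, one_pos, fun z h1 h2 => ?_⟩
      have : z ∈ {z | dist q z = t ∧ z ∉ OmegaSeq p q lam 1} := ⟨h1, h2⟩
      rw [he] at this
      exact this.elim
    · obtain ⟨z₀, hz₀, hmin⟩ := hK.exists_isMinOn hne
        (f := fun z => dist z x) (by fun_prop)
      refine ⟨dist z₀ x - (dist q x - t), sub_pos.2 (hgap z₀ hz₀), fun z h1 h2 => ?_⟩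
      have := hmin (show z ∈ {z | dist q z = t ∧ z ∉ OmegaSeq p q lam 1} from ⟨h1, h2⟩)
      simp only [Set.mem_ofPred_eq] at this
      linarith
  set δ' := min (dist q x - t) (δ / (2 + lam)) with hδ'
  have h2l : 0 < 2 + lam := by linarith
  have hδ'0 : 0 < δ' := lt_min (sub_pos.2 htD) (div_pos hδ0 h2l)
  have hδ'1 : δ' * (2 + lam) ≤ δ := by
    rw [← le_div_iff₀ h2l]; exact min_le_right _ _
  have hball : ball x δ' ⊆ Omega p q lam := by
    intro y hy
    rw [mem_ball] at hy
    by_cases hy1 : y ∈ OmegaSeq p q lam 1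
    · exact OmegaSeq_subset_Omega p q lam 1 hy1
    refine OmegaSeq_subset_Omega p q lam 2 (Or.inr ⟨hy1, ?_⟩)
    have hlow : ENNReal.ofReal (dist q x + δ - δ') ≤ dCompl (OmegaSeq p q lam 1) y q := by
      refine le_dCompl fun T c hT h0 h1 hc hS => ?_
      have hcont : ContinuousOn (fun s => dist q (c s)) (Icc 0 T) := by fun_prop
      have hmem : t ∈ Icc (dist q (c T)) (dist q (c 0)) := by
        rw [h0, h1, dist_self]
        refine ⟨ht.1, ?_⟩
        have e1 := dist_triangle q y x
        have e2 : δ' ≤ dist q x - t := min_le_left _ _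
        linarith
      obtain ⟨s, hs, hst⟩ := intermediate_value_Icc' hT hcont hmem
      refine ⟨s, hs, ?_⟩
      have e1 := hδ (c s) hst (hS s hs)
      have e2 := dist_triangle (c s) y x
      simp only at hst
      rw [dist_comm (c s) q, hst, dist_comm y]
      linarith
    refine lt_of_lt_of_le ?_ hlow
    rw [ENNReal.ofReal_lt_ofReal_iff_of_nonneg (mul_nonneg hlam dist_nonneg)]
    have e1 := mul_le_mul_of_nonneg_left (dist_triangle y x p) hlam
    have e2 := mul_le_mul_of_nonneg_left hy.le hlam
    rw [dist_comm q x, hxe]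
    linarith
  exact hx.2 (interior_maximal hball isOpen_ball (mem_ball_self hδ'0))

end Omega

section Radial

variable {n : ℕ} {p : M} {G : ℝ → ℝ} {Φ : Euc n ≃ M} {a : Euc n} {lam : ℝ}

theorem self_le_warping (hw : IsWarping G) (hnpc : NonposCurvWarping G) (r : ℝ) (hr : 0 < r) :
    r ≤ G r := by
  obtain ⟨g, g₁, H, h, hgG⟩ := exists_isRadialProfile hw hnpc
  rw [← hgG r hr]
  exact h.self_le r

theorem dist_smul_self (hsym : IsSphericallySymmetric p G Φ) (hnpc : NonposCurvWarping G)
    (z : Euc n) {κ : ℝ} (hκ : κ ≤ 1) : dist (Φ (κ • z)) (Φ z) = (1 - κ) * ‖z‖ := by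
  rcases eq_or_ne z 0 with rfl | hz
  · simp
  have h := dist_smul_smul hsym (self_le_warping hsym.1 hnpc) (norm_inv_norm_smul hz)
    (κ * ‖z‖) ‖z‖
  rw [mul_smul, smul_inv_smul₀ (norm_ne_zero_iff.2 hz)] at h
  rw [h, abs_sub_comm, abs_of_nonneg (by nlinarith [norm_nonneg z])]
  ring

theorem exists_isMinGeodesicFromTo_of_ne (hsym : IsSphericallySymmetric p G Φ)
    (hnpc : NonposCurvWarping G) {q : M} (hq : q ≠ p) (x : M) :
    ∃ γ, IsMinGeodesicFromTo γ q x ∧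
      ∀ z, dist q z + dist z x = dist q x → z = γ (dist q z) := by
  have ha : Φ.symm q ≠ 0 := fun h => hq (by rw [← hsym.2.1, ← h, Φ.apply_symm_apply])
  obtain ⟨γ, hγ, hu⟩ := exists_isMinGeodesicFromTo hsym hnpc ha (Φ.symm x)
  simp only [Φ.apply_symm_apply] at hγ hu
  refine ⟨γ, hγ, fun z => ?_⟩
  have := hu (Φ.symm z)
  simpa only [Φ.apply_symm_apply] using this

theorem mem_OmegaSeq_one_iff (hsym : IsSphericallySymmetric p G Φ) (hnpc : NonposCurvWarping G)
    (hlam : 1 < lam) (ha : a ≠ 0) (z : Euc n) :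
    Φ z ∈ OmegaSeq p (Φ a) lam 1 ↔ lam * ‖z‖ < dist (Φ z) (Φ a) := by
  rw [mem_OmegaSeq_one (by linarith) ((exists_isMinGeodesicFromTo hsym hnpc ha z).imp
    fun _ h => h.1), hsym.2.2.1]

theorem smul_mem_OmegaSeq_one_of_le (hsym : IsSphericallySymmetric p G Φ)
    (hnpc : NonposCurvWarping G) (hlam : 1 < lam) (ha : a ≠ 0) {z : Euc n} (hz : z ≠ 0)
    (hle : lam * ‖z‖ ≤ dist (Φ z) (Φ a)) {κ : ℝ} (h0 : 0 ≤ κ) (h1 : κ < 1) :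
    Φ (κ • z) ∈ OmegaSeq p (Φ a) lam 1 := by
  rw [mem_OmegaSeq_one_iff hsym hnpc hlam ha, norm_smul, Real.norm_of_nonneg h0]
  have e1 := dist_triangle (Φ z) (Φ (κ • z)) (Φ a)
  rw [dist_comm (Φ z) (Φ (κ • z)), dist_smul_self hsym hnpc z h1.le] at e1
  have := mul_pos (mul_pos (sub_pos.2 hlam) (sub_pos.2 h1)) (norm_pos_iff.2 hz)
  nlinarith

theorem smul_mem_OmegaSeq_one (hsym : IsSphericallySymmetric p G Φ)
    (hnpc : NonposCurvWarping G) (hlam : 1 < lam) (ha : a ≠ 0) {z : Euc n}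
    (hmem : Φ z ∈ OmegaSeq p (Φ a) lam 1) {κ : ℝ} (h0 : 0 ≤ κ) (h1 : κ ≤ 1) :
    Φ (κ • z) ∈ OmegaSeq p (Φ a) lam 1 := by
  rcases h1.eq_or_lt with rfl | h1
  · rwa [one_smul]
  rcases eq_or_ne z 0 with rfl | hz
  · rwa [smul_zero]
  exact smul_mem_OmegaSeq_one_of_le hsym hnpc hlam ha hz
    ((mem_OmegaSeq_one_iff hsym hnpc hlam ha z).1 hmem).le h0 h1

theorem apply_not_mem_OmegaSeq_one (hsym : IsSphericallySymmetric p G Φ)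
    (hnpc : NonposCurvWarping G) (hlam : 1 < lam) (ha : a ≠ 0) :
    Φ a ∉ OmegaSeq p (Φ a) lam 1 := by
  rw [mem_OmegaSeq_one_iff hsym hnpc hlam ha, dist_self, not_lt]
  positivity

theorem zero_mem_OmegaSeq_one (hsym : IsSphericallySymmetric p G Φ)
    (hnpc : NonposCurvWarping G) (hlam : 1 < lam) (ha : a ≠ 0) :
    Φ 0 ∈ OmegaSeq p (Φ a) lam 1 := by
  rw [mem_OmegaSeq_one_iff hsym hnpc hlam ha, norm_zero, mul_zero, hsym.2.1, dist_comm,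
    hsym.2.2.1]
  exact norm_pos_iff.2 ha

theorem mem_frontier_OmegaSeq_one_iff (hsym : IsSphericallySymmetric p G Φ)
    (hnpc : NonposCurvWarping G) (hlam : 1 < lam) (ha : a ≠ 0) {z : Euc n} (hz : z ≠ 0) :
    Φ z ∈ frontier (OmegaSeq p (Φ a) lam 1) ↔ dist (Φ z) (Φ a) = lam * ‖z‖ := by
  have hqp : Φ a ≠ p := fun h => ha (Φ.injective (h.trans hsym.2.1.symm))
  have hgeo : ∀ x, ∃ γ, IsMinGeodesicFromTo γ (Φ a) x := fun x =>
    (exists_isMinGeodesicFromTo_of_ne hsym hnpc hqp x).imp fun _ h => h.1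
  have hopen : IsOpen (OmegaSeq p (Φ a) lam 1) := isOpen_OmegaSeq_one (by linarith) hgeo
  rw [hopen.frontier_eq, Set.mem_sdiff, mem_OmegaSeq_one_iff hsym hnpc hlam ha, not_lt]
  constructor
  · rintro ⟨h1, h2⟩
    refine le_antisymm h2 ?_
    have hcl : IsClosed {x | lam * dist x p ≤ dist x (Φ a)} :=
      isClosed_le (by fun_prop) (by fun_prop)
    have : lam * dist (Φ z) p ≤ dist (Φ z) (Φ a) := closure_minimal
      (fun x hx => ((mem_OmegaSeq_one (by linarith) (hgeo x)).1 hx).le) hcl h1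
    rwa [hsym.2.2.1] at this
  · intro h
    refine ⟨Metric.mem_closure_iff.2 fun ε hε => ?_, h.le⟩
    have hzn := norm_pos_iff.2 hz
    set δ := min 1 (ε / (2 * ‖z‖)) with hδ
    have hδ0 : 0 < δ := lt_min one_pos (by positivity)
    have hδ1 : δ * (2 * ‖z‖) ≤ ε := by
      rw [← le_div_iff₀ (by positivity)]; exact min_le_right _ _
    refine ⟨_, smul_mem_OmegaSeq_one_of_le hsym hnpc hlam ha hz h.ge (κ := 1 - δ)
      (by linarith [min_le_left 1 (ε / (2 * ‖z‖))]) (by linarith), ?_⟩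
    rw [dist_comm, dist_smul_self hsym hnpc z (by linarith)]
    nlinarith

theorem exists_sSup_smul_eq (hsym : IsSphericallySymmetric p G Φ)
    (hnpc : NonposCurvWarping G) (hlam : 1 < lam) (ha : a ≠ 0) {z : Euc n} (hz : z ≠ 0)
    (hmem : Φ z ∉ OmegaSeq p (Φ a) lam 1) :
    ∃ r ∈ Ioc (0 : ℝ) 1,
      sSup {s : ℝ | Φ (s • ‖z‖⁻¹ • z) ∈ OmegaSeq p (Φ a) lam 1} • ‖z‖⁻¹ • z = r • z ∧
      (dist (Φ z) (Φ a) = lam * ‖z‖ → r = 1) := by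
  have hzn := norm_pos_iff.2 hz
  set S := {s : ℝ | Φ (s • ‖z‖⁻¹ • z) ∈ OmegaSeq p (Φ a) lam 1} with hS
  have hresc : ∀ s : ℝ, s • ‖z‖⁻¹ • z = (s * ‖z‖⁻¹) • z := fun s => (mul_smul _ _ _).symm
  have hub : ∀ s ∈ S, s ≤ ‖z‖ := by
    intro s hs
    by_contra hlt
    push Not at hlt
    have hs0 : 0 < s := hzn.trans hlt
    have := smul_mem_OmegaSeq_one hsym hnpc hlam ha hs (κ := ‖z‖ / s) (by positivity)
      ((div_le_one hs0).2 hlt.le)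
    rw [smul_smul, div_mul_cancel₀ _ hs0.ne', smul_inv_smul₀ hzn.ne'] at this
    exact hmem this
  have hbdd : BddAbove S := ⟨‖z‖, hub⟩
  have han := norm_pos_iff.2 ha
  have hpos : ∃ s ∈ S, 0 < s := by
    have h1l : 0 < 2 * (1 + lam) := by linarith
    refine ⟨‖a‖ / (2 * (1 + lam)), ?_, div_pos han h1l⟩
    rw [hS, Set.mem_ofPred_eq, mem_OmegaSeq_one_iff hsym hnpc hlam ha, norm_smul,
      norm_inv_norm_smul hz, mul_one, Real.norm_of_nonneg (div_pos han h1l).le]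
    set s := ‖a‖ / (2 * (1 + lam)) with hs
    have hse : s * (2 * (1 + lam)) = ‖a‖ := div_mul_cancel₀ _ h1l.ne'
    have e1 := dist_triangle (Φ a) (Φ (s • ‖z‖⁻¹ • z)) p
    rw [hsym.2.2.1, hsym.2.2.1, norm_smul, norm_inv_norm_smul hz, mul_one,
      Real.norm_of_nonneg (div_pos han h1l).le, dist_comm] at e1
    nlinarith
  obtain ⟨s₀, hs₀, hs₀0⟩ := hpos
  have hsup0 : 0 < sSup S := hs₀0.trans_le (le_csSup hbdd hs₀)
  have hsup1 : sSup S ≤ ‖z‖ := csSup_le ⟨s₀, hs₀⟩ hub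
  refine ⟨sSup S * ‖z‖⁻¹, ⟨by positivity, ?_⟩, hresc _, fun he => ?_⟩
  · rw [← div_eq_mul_inv]; exact (div_le_one hzn).2 hsup1
  · by_contra hne
    have hlt : sSup S < ‖z‖ := lt_of_le_of_ne hsup1 fun h => hne (by
      rw [h, mul_inv_cancel₀ hzn.ne'])
    have hm : (sSup S + ‖z‖) / 2 ∈ S := by
      rw [hS, Set.mem_ofPred_eq, hresc]
      refine smul_mem_OmegaSeq_one_of_le hsym hnpc hlam ha hz he.ge (by positivity) ?_
      rw [← div_eq_mul_inv, div_lt_one hzn]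
      linarith
    linarith [le_csSup hbdd hm]

/-- Minimizing geodesics from `Φ a` to points outside `Ω₁` within the visibility cone avoid `Ω₁`
and remain in the cone. -/
theorem not_mem_OmegaSeq_one_of_tight (hsym : IsSphericallySymmetric p G Φ)
    (hnpc : NonposCurvWarping G) (hlam : 1 < lam) (ha : a ≠ 0) {α : ℝ} (hαpi : α < Real.pi)
    (hvis : ∀ θ : Euc n, ‖θ‖ = 1 → angle a θ ≤ α → VisibleThrough (OmegaSeq p (Φ a) lam 1) (Φ a)
      (Φ (sSup {s : ℝ | Φ (s • θ) ∈ OmegaSeq p (Φ a) lam 1} • θ)))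
    {z w : Euc n} (hz : Φ z ∉ OmegaSeq p (Φ a) lam 1) (hα : angle a z ≤ α)
    (hw : dist (Φ a) (Φ w) + dist (Φ w) (Φ z) = dist (Φ a) (Φ z)) :
    Φ w ∉ OmegaSeq p (Φ a) lam 1 ∧ angle a w ≤ α := by
  have hz0 : z ≠ 0 := fun h => hz (h ▸ zero_mem_OmegaSeq_one hsym hnpc hlam ha)
  rcases (angle_nonneg a z).eq_or_lt with h0 | h0
  · obtain ⟨-, r, hr, rfl⟩ := angle_eq_zero_iff.1 h0.symm
    have han := norm_pos_iff.2 ha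
    have e1 : ∀ s : ℝ, (s * ‖a‖) • ‖a‖⁻¹ • a = s • a := fun s => by
      rw [mul_smul, smul_inv_smul₀ han.ne']
    obtain ⟨t, ht, rfl⟩ := exists_of_tight_collinear hsym (self_le_warping hsym.1 hnpc)
      (norm_inv_norm_smul ha) (s := 1 * ‖a‖) (c := r * ‖a‖) (z := w)
      (by rw [e1, e1, one_smul]; exact hw)
    have hk : (1 * ‖a‖ + t * (r * ‖a‖ - 1 * ‖a‖)) • ‖a‖⁻¹ • a = (1 + t * (r - 1)) • a := by
      rw [← e1 (1 + t * (r - 1))]; congr 1; ring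
    rw [hk]
    have hk0 : 0 < 1 + t * (r - 1) := by
      rcases le_total 1 r with h1 | h1
      · linarith [mul_nonneg ht.1 (sub_nonneg.2 h1)]
      · linarith [mul_nonneg (sub_nonneg.2 ht.2) (sub_nonneg.2 h1)]
    refine ⟨fun hm => ?_, by rw [angle_smul_right_of_pos _ _ hk0, angle_self ha]; linarith⟩
    rcases le_total 1 r with h1 | h1
    · have := smul_mem_OmegaSeq_one hsym hnpc hlam ha hm (κ := (1 + t * (r - 1))⁻¹)
        (by positivity) (inv_le_one_of_one_le₀ (by nlinarith [ht.1]))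
      rw [inv_smul_smul₀ hk0.ne'] at this
      exact apply_not_mem_OmegaSeq_one hsym hnpc hlam ha this
    · have := smul_mem_OmegaSeq_one hsym hnpc hlam ha hm (κ := r / (1 + t * (r - 1)))
        (by positivity) ((div_le_one hk0).2 (by nlinarith [ht.2]))
      rw [smul_smul, div_mul_cancel₀ _ hk0.ne'] at this
      exact hz this
  · obtain ⟨r, hr, hre, -⟩ := exists_sSup_smul_eq hsym hnpc hlam ha hz0 hz
    obtain ⟨hang, κ, hκ, ht⟩ := exists_tight_smul hsym hnpc ha hz0 h0 (hα.trans_lt hαpi) hr.1 hr.2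
      hw
    refine ⟨fun hm => ?_, hang.trans hα⟩
    have hv := hvis _ (norm_inv_norm_smul hz0) (by rwa [angle_inv_norm_smul_right _ hz0])
    rw [hre] at hv
    obtain ⟨γ, hγ, hu⟩ := exists_isMinGeodesicFromTo hsym hnpc ha (r • z)
    refine hv γ hγ (dist (Φ a) (Φ (κ • w))) ⟨dist_nonneg, ?_⟩ ?_
    · linarith [dist_nonneg (x := Φ (κ • w)) (y := Φ (r • z))]
    · rw [← hu _ ht]
      exact smul_mem_OmegaSeq_one hsym hnpc hlam ha hm hκ.1.le hκ.2

theorem mem_OmegaSeq_one_of_mem (hsym : IsSphericallySymmetric p G Φ)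
    (hnpc : NonposCurvWarping G) (hlam : 1 < lam) (ha : a ≠ 0) {α : ℝ} (hαpi : α < Real.pi)
    (hvis : ∀ θ : Euc n, ‖θ‖ = 1 → angle a θ ≤ α → VisibleThrough (OmegaSeq p (Φ a) lam 1) (Φ a)
      (Φ (sSup {s : ℝ | Φ (s • θ) ∈ OmegaSeq p (Φ a) lam 1} • θ)))
    (k : ℕ) {z : Euc n} (hα : angle a z ≤ α) (hz : Φ z ∈ OmegaSeq p (Φ a) lam k) :
    Φ z ∈ OmegaSeq p (Φ a) lam 1 := by
  induction k generalizing z with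
  | zero => exact absurd hz (Set.notMem_empty _)
  | succ k ih =>
    rcases hz with hz | ⟨-, hz⟩
    · exact ih hα hz
    by_contra hz1
    obtain ⟨γ, hγ, -⟩ := exists_isMinGeodesicFromTo hsym hnpc ha z
    have hav : ∀ t ∈ Icc 0 (dist (Φ a) (Φ z)), γ t ∉ OmegaSeq p (Φ a) lam k := fun t ht hm => by
      have h1 := hγ.tight ht
      rw [← Φ.apply_symm_apply (γ t)] at h1 hm
      obtain ⟨h2, h3⟩ := not_mem_OmegaSeq_one_of_tight hsym hnpc hlam ha hαpi hvis hz1 hα h1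
      exact h2 (ih h3 hm)
    have h1 := dCompl_le_of_isMinGeodesicFromTo (S := OmegaSeq p (Φ a) lam k) hγ.reverse
      fun t ht => hav _ (by
        rw [dist_comm (Φ z)] at ht
        exact ⟨by linarith [ht.2], by linarith [ht.1]⟩)
    have h2 := hz.trans_le h1
    rw [ENNReal.ofReal_lt_ofReal_iff_of_nonneg (mul_nonneg (by linarith) dist_nonneg),
      hsym.2.2.1] at h2
    exact hz1 ((mem_OmegaSeq_one_iff hsym hnpc hlam ha z).2 h2)

theorem angle_polarTheta {x y : M} (hx : Φ.symm x ≠ 0) (hy : Φ.symm y ≠ 0) :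
    angle (polarTheta Φ x) (polarTheta Φ y) = angle (Φ.symm x) (Φ.symm y) := by
  rw [polarTheta, polarTheta, angle_inv_norm_smul_left hx, angle_inv_norm_smul_right _ hy]

end Radial

/-- Corollary 3.5.  Suppose `M` is spherically symmetric
about `p` and nonpositively curved, and let `a ∈ (0,π)` be as in Lemma 3.4
(the visibility angle for `∂Ω_1`, i.e. `(f₁(θ),θ) ∈ ∂Ω_1` is visible₁ iff
`∠(θ,u₀) ≤ a`).  Then for a point `x = (f(θ),θ) ∈ ∂Ω` the following are
equivalent: (i) `x` is visible; (ii) `∠(θ,u₀) ≤ a`; (iii) `x ∈ ∂Ω_1`. -/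
theorem visible_iff_angle_iff_omega1_boundary
    {M : Type*} [MetricSpace M] [ProperSpace M] {n : ℕ}
    (p : M) (G : ℝ → ℝ) (Φ : Euc n ≃ M)
    (hsym : IsSphericallySymmetric p G Φ) (hnpc : NonposCurvWarping G)
    (q : M) (hq : q ≠ p) (lam : ℝ) (hlam : 1 < lam)
    (a : ℝ) (ha0 : 0 < a) (haPi : a < Real.pi)
    (ha : ∀ θ : Euc n, ‖θ‖ = 1 →
      (VisibleThrough (OmegaSeq p q lam 1) q
          (Φ (sSup {r : ℝ | Φ (r • θ) ∈ OmegaSeq p q lam 1} • θ)) ↔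
        angle θ (polarTheta Φ q) ≤ a)) :
    ∀ x ∈ frontier (Omega p q lam),
      (VisibleThrough (Omega p q lam) q x ↔
        angle (polarTheta Φ x) (polarTheta Φ q) ≤ a) ∧
      (VisibleThrough (Omega p q lam) q x ↔
        x ∈ frontier (OmegaSeq p q lam 1)) := by
  intro x hx
  obtain ⟨u, rfl⟩ := Φ.surjective q
  obtain ⟨z, rfl⟩ := Φ.surjective x
  have hu : u ≠ 0 := fun h => hq (by rw [h, hsym.2.1])
  have hgeo := exists_isMinGeodesicFromTo_of_ne hsym hnpc hq
  have hgeo' : ∀ x, ∃ γ, IsMinGeodesicFromTo γ (Φ u) x := fun x => (hgeo x).imp fun _ h => h.1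
  have hl0 : 0 ≤ lam := by linarith
  have hx1 := not_mem_OmegaSeq_one_of_mem_frontier hl0 hgeo' hx
  have hz : z ≠ 0 := fun h => hx1 (h ▸ zero_mem_OmegaSeq_one hsym hnpc hlam hu)
  have hxp : Φ z ≠ p := fun h => hz (Φ.injective (h.trans hsym.2.1.symm))
  have hgeox : ∀ y, ∃ γ, IsMinGeodesicFromTo γ (Φ z) y := fun y =>
    (exists_isMinGeodesicFromTo_of_ne hsym hnpc hxp y).imp fun _ h => h.1
  have hang : angle (polarTheta Φ (Φ z)) (polarTheta Φ (Φ u)) = angle u z := by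
    rw [angle_polarTheta (by rwa [Φ.symm_apply_apply]) (by rwa [Φ.symm_apply_apply]),
      Φ.symm_apply_apply, Φ.symm_apply_apply, angle_comm]
  have hangle : ∀ θ : Euc n, angle θ (polarTheta Φ (Φ u)) = angle u θ := fun θ => by
    rw [polarTheta, Φ.symm_apply_apply, angle_inv_norm_smul_right _ hu, angle_comm]
  have hvis : ∀ θ : Euc n, ‖θ‖ = 1 → angle u θ ≤ a →
      VisibleThrough (OmegaSeq p (Φ u) lam 1) (Φ u)
        (Φ (sSup {s : ℝ | Φ (s • θ) ∈ OmegaSeq p (Φ u) lam 1} • θ)) := fun θ hθ h =>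
    (ha θ hθ).2 (by rwa [hangle])
  rw [hang]
  have h13 : VisibleThrough (Omega p (Φ u) lam) (Φ u) (Φ z) →
      Φ z ∈ frontier (OmegaSeq p (Φ u) lam 1) := fun h => by
    rw [mem_frontier_OmegaSeq_one_iff hsym hnpc hlam hu hz,
      dist_eq_of_visibleThrough hl0 hgeo' hx hgeox h, hsym.2.2.1]
  have h32 : Φ z ∈ frontier (OmegaSeq p (Φ u) lam 1) → angle u z ≤ a := fun h => by
    have he := (mem_frontier_OmegaSeq_one_iff hsym hnpc hlam hu hz).1 h
    have hv := visibleThrough_of_mem_frontier hl0 hgeo hx (by rw [he, hsym.2.2.1])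
    obtain ⟨r, -, hr, hr1⟩ := exists_sSup_smul_eq hsym hnpc hlam hu hz hx1
    rw [hr1 he, one_smul] at hr
    have := (ha _ (norm_inv_norm_smul hz)).1 (by rwa [hr])
    rwa [hangle, angle_inv_norm_smul_right _ hz] at this
  have h21 : angle u z ≤ a → VisibleThrough (Omega p (Φ u) lam) (Φ u) (Φ z) := by
    intro h γ hγ t ht hm
    obtain ⟨k, hk⟩ := mem_iUnion.1 hm
    have h1 := hγ.tight ht
    rw [← Φ.apply_symm_apply (γ t)] at h1 hk
    obtain ⟨h2, h3⟩ := not_mem_OmegaSeq_one_of_tight hsym hnpc hlam hu haPi hvis hx1 h h1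
    exact h2 (mem_OmegaSeq_one_of_mem hsym hnpc hlam hu haPi hvis _ h3 hk)
  exact ⟨⟨fun h => h32 (h13 h), h21⟩, ⟨h13, fun h => h21 (h32 h)⟩⟩

end GrowthComp
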